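/- Fix an integer d ≥ 3 and a finite set M. For every invariant process X with law in I_d(M) and every integer r ≥ 1, one has Σ_{r+1}(X) ≤ Σ_r(X), with equality if and only if the restriction X_{S_{r+1}} of X to the ball S_{r+1} is an r-Markov process on S_{r+1}. -/

import Mathlib

open MeasureTheory Filter Topology
open scoped ENNReal Classical

noncomputable section

namespace TreeEntropy

@[ext]
structure RCG (M : Type*) where
  col : List ℕ → Option M
  adj : List ℕ × List ℕ → Bool

variable {M : Type*}

def resS (r : ℕ) (g : RCG M) : RCG M where
  col l := if l.length ≤ r then g.col l else none
  adj p := if p.1.length ≤ r ∧ p.2.length ≤ r then g.adj p else false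

def rcgDist (g g' : RCG M) : ℝ :=
  ∑' r : ℕ, if resS r g = resS r g' then 0 else (2:ℝ)⁻¹ ^ r

private lemma rcg_summable (a b : RCG M) : Summable
    (fun r : ℕ => if resS r a = resS r b then (0:ℝ) else (2:ℝ)⁻¹ ^ r) := by
  refine Summable.of_nonneg_of_le (fun r => ?_) (fun r => ?_)
    (summable_geometric_of_lt_one (by norm_num) (by norm_num : (2:ℝ)⁻¹ < 1))
  · split
    · exact le_rfl
    · positivity
  · split
    · positivity
    · exact le_rfl

private lemma rcg_nonneg (a b : RCG M) (r : ℕ) :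
    (0:ℝ) ≤ if resS r a = resS r b then (0:ℝ) else (2:ℝ)⁻¹ ^ r := by
  split
  · exact le_rfl
  · positivity

private lemma rcgDist_self (g : RCG M) : rcgDist g g = 0 := by simp [rcgDist]

private lemma rcgDist_comm (g g' : RCG M) : rcgDist g g' = rcgDist g' g :=
  tsum_congr fun r => if_congr eq_comm rfl rfl

private lemma rcgDist_triangle (g₁ g₂ g₃ : RCG M) :
    rcgDist g₁ g₃ ≤ rcgDist g₁ g₂ + rcgDist g₂ g₃ := by
  unfold rcgDist
  rw [← Summable.tsum_add (rcg_summable _ _) (rcg_summable _ _)]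
  refine Summable.tsum_le_tsum (fun r => ?_) (rcg_summable _ _)
    ((rcg_summable _ _).add (rcg_summable _ _))
  have hx : (0:ℝ) ≤ (2:ℝ)⁻¹ ^ r := by positivity
  by_cases h12 : resS r g₁ = resS r g₂
  · by_cases h23 : resS r g₂ = resS r g₃
    · rw [if_pos h12, if_pos h23, if_pos (h12.trans h23)]; linarith
    · rw [if_pos h12, if_neg h23, zero_add]
      split_ifs <;> linarith
  · by_cases h23 : resS r g₂ = resS r g₃
    · rw [if_neg h12, if_pos h23, add_zero]
      split_ifs <;> linarith
    · rw [if_neg h12, if_neg h23]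
      split_ifs <;> linarith

private lemma rcgDist_eq_zero (g g' : RCG M) (h : rcgDist g g' = 0) : g = g' := by
  unfold rcgDist at h
  have hr : ∀ r : ℕ, resS r g = resS r g' := by
    intro r
    by_contra hne
    have hpos : (0:ℝ) <
        ∑' r : ℕ, if resS r g = resS r g' then (0:ℝ) else (2:ℝ)⁻¹ ^ r :=
      Summable.tsum_pos (rcg_summable g g') (rcg_nonneg g g') r
        (by rw [if_neg hne]; positivity)
    exact absurd h hpos.ne'
  have hc : g.col = g'.col := by
    funext l
    have h1 := congrFun (congrArg RCG.col (hr l.length)) l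
    simpa [resS] using h1
  have ha : g.adj = g'.adj := by
    funext p
    have h1 := congrFun (congrArg RCG.adj (hr (max p.1.length p.2.length))) p
    simpa [resS, le_max_left, le_max_right] using h1
  exact RCG.ext hc ha

instance : MetricSpace (RCG M) where
  dist := rcgDist
  dist_self := rcgDist_self
  dist_comm := rcgDist_comm
  dist_triangle := rcgDist_triangle
  eq_of_dist_eq_zero := rcgDist_eq_zero _ _

instance : MeasurableSpace (RCG M) := borel _
instance : BorelSpace (RCG M) := ⟨rfl⟩


/-! ### The `d`-regular tree `T_d` -/

/-- A list `l = [i_k, …, i_1]` (deepest step first) is the breadth-first-search label of a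
vertex of the `d`-regular tree `T_d` iff its first (root-side) step lies in `{1, …, d}` and all
subsequent steps lie in `{1, …, d-1}`. -/
def ValidTd (d : ℕ) (l : List ℕ) : Prop :=
  (∀ i ∈ l.dropLast, 1 ≤ i ∧ i ≤ d - 1) ∧ (∀ i ∈ l.getLast?, 1 ≤ i ∧ i ≤ d)

/-- The vertex set of the `d`-regular tree `T_d`. -/
def TdVertex (d : ℕ) : Type := {l : List ℕ // ValidTd d l}

/-- The root `o` of `T_d`. -/
def rootTd (d : ℕ) : TdVertex d := ⟨[], by constructor <;> simp [List.getLast?]⟩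

/-- The first neighbor `1` of the root of `T_d` (defined as the root for the degenerate case
`d = 0`, which never occurs below). -/
def node1 (d : ℕ) : TdVertex d :=
  if h : 1 ≤ d then ⟨[1], by constructor <;> simp [List.getLast?, h]⟩ else rootTd d

/-- The graph structure of the `d`-regular tree: two vertices are adjacent iff one is obtained
from the other by adding one step. -/
def TdGraph (d : ℕ) : SimpleGraph (TdVertex d) where
  Adj v w := (∃ i, w.1 = i :: v.1) ∨ (∃ i, v.1 = i :: w.1)
  symm := ⟨by intro v w h; tauto⟩
  loopless := ⟨by
    rintro v (⟨i, h⟩ | ⟨i, h⟩) <;>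
      · have := congrArg List.length h
        simp at this⟩

/-- Graph distance between two vertices of a tree encoded by their BFS labels: the nearest
common ancestor corresponds to the longest common suffix. -/
def treeDist (u w : List ℕ) : ℕ :=
  ((u.reverse.zip w.reverse).takeWhile (fun p => p.1 = p.2)).length |> fun c =>
    (u.length - c) + (w.length - c)

/-- The ball `S_r = B_r(o)` of radius `r` around the root of `T_d`. -/
def SrSet (d r : ℕ) : Set (TdVertex d) := {v | v.1.length ≤ r}

/-- The set `E_r = B_{r-1}({o,1})` of vertices at distance at most `r-1` from the edge `{o,1}`
of `T_d` (for `r ≥ 1`). -/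
def ErSet (d r : ℕ) : Set (TdVertex d) :=
  {v | v.1.length + 1 ≤ r ∨ (v.1.getLast? = some 1 ∧ v.1.length ≤ r)}

lemma ErSet_subset_SrSet (d r : ℕ) : ErSet d r ⊆ SrSet d r := by
  rintro v (h | ⟨-, h⟩) <;> simp only [SrSet, Set.mem_setOf_eq] <;> omega

/-! ### Invariant processes on `T_d` and their entropies -/

variable (d : ℕ) (M : Type*)

/-- `I_d(M)`: the set of probability measures on `M^{T_d}` invariant under all automorphisms
of the tree `T_d`. -/
def InvMeas [MeasurableSpace M] : Set (Measure (TdVertex d → M)) :=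
  {μ | IsProbabilityMeasure μ ∧
    ∀ φ : TdGraph d ≃g TdGraph d, μ.map (fun x => fun v => x (φ v)) = μ}

variable {d M}

/-- The Shannon entropy of (the distribution of) a random variable with law `μ`, a measure
with countable support on a discrete space. -/
def shannon {α : Type*} [MeasurableSpace α] (μ : Measure α) : ℝ :=
  ∑' a : α, Real.negMulLog (μ {a}).toReal

/-- The restriction `X_S` of a process `X` on `T_d` to a subset `S` of the vertices:
the pushforward of its law. -/
def restrictTo [MeasurableSpace M] (S : Set (TdVertex d))
    (μ : Measure (TdVertex d → M)) : Measure (↥S → M) :=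
  μ.map (fun x => fun v => x v.1)

/-- The annealed entropy `Σ_r(μ) = H(X_{S_r}) - (d/2) H(X_{E_r})`. -/
def SigmaR [MeasurableSpace M] (d : ℕ) (r : ℕ) (μ : Measure (TdVertex d → M)) : ℝ :=
  shannon (restrictTo (SrSet d r) μ) - (d / 2 : ℝ) * shannon (restrictTo (ErSet d r) μ)

/-- The annealed entropy `Σ(μ) = lim_r Σ_r(μ)`: the limit of the non-increasing sequence
`r ↦ Σ_r(μ)` (`r ≥ 1`), as an extended real (the limit may be `-∞`). -/
def SigmaInf [MeasurableSpace M] (d : ℕ) (μ : Measure (TdVertex d → M)) : EReal :=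
  ⨅ r : ℕ, ((SigmaR d (r + 1) μ : ℝ) : EReal)

/-- `Σ_e(X) = (d/2) H(X_{E_1}) - (d-1) H(X_o)`. -/
def SigmaE [MeasurableSpace M] (d : ℕ) (μ : Measure (TdVertex d → M)) : ℝ :=
  (d / 2 : ℝ) * shannon (restrictTo (ErSet d 1) μ)
    - ((d : ℝ) - 1) * shannon (restrictTo ({rootTd d} : Set (TdVertex d)) μ)

/-! ### Markov processes on `T_d` -/

/-- The elementary cylinder event: the coloring takes the values prescribed by `y` on `S`. -/
def cylEvent (S : Set (TdVertex d)) (y : TdVertex d → M) : Set (TdVertex d → M) :=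
  {x | ∀ v ∈ S, x v = y v}

/-- The side of the edge `{u,w}` containing `u`, in the tree `T_d`. -/
def sideOf (u w : TdVertex d) : Set (TdVertex d) :=
  {v | treeDist v.1 u.1 < treeDist v.1 w.1}

/-- `B_{r-1}({u,w})`: the set of vertices at distance at most `r-1` from the edge `{u,w}`. -/
def edgeBall (r : ℕ) (u w : TdVertex d) : Set (TdVertex d) :=
  {v | treeDist v.1 u.1 + 1 ≤ r ∨ treeDist v.1 w.1 + 1 ≤ r}

/-- A probability measure on `M^{T_d}` is `r`-Markov on a subset `A` of `T_d` if, for every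
edge `{u,w}` of `A`, conditioned on the value on the `(r-1)`-neighborhood of the edge
(within `A`), the processes on the two sides of the edge (within `A`) are independent;
equivalently, the corresponding products of cylinder probabilities agree.  For `A` the whole
tree and `r = 1` this is the edge-Markov property. -/
def rMarkovOn [MeasurableSpace M] (r : ℕ) (A : Set (TdVertex d))
    (μ : Measure (TdVertex d → M)) : Prop :=
  ∀ u w : TdVertex d, u ∈ A → w ∈ A → (TdGraph d).Adj u w →
    ∀ F₁ F₂ : Finset (TdVertex d), ↑F₁ ⊆ sideOf u w ∩ A → ↑F₂ ⊆ sideOf w u ∩ A →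
      ∀ y : TdVertex d → M,
        μ (cylEvent (↑F₁ ∪ ↑F₂ ∪ (edgeBall r u w ∩ A)) y)
            * μ (cylEvent (edgeBall r u w ∩ A) y)
          = μ (cylEvent (↑F₁ ∪ (edgeBall r u w ∩ A)) y)
            * μ (cylEvent (↑F₂ ∪ (edgeBall r u w ∩ A)) y)

/-- A probability measure on `M^{T_d}` is `r`-Markov if, conditioned on the value on the
`(r-1)`-neighborhood of any edge, the processes on the two sides of the edge are
independent. -/
def rMarkov [MeasurableSpace M] (r : ℕ) (μ : Measure (TdVertex d → M)) : Prop :=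
  rMarkovOn r Set.univ μ

/-- A probability measure on `M^{T_d}` is vertex-Markov if, conditioned on the value at a
vertex, the processes on the pending subtrees of that vertex are independent. -/
def vertexMarkov [MeasurableSpace M] (μ : Measure (TdVertex d → M)) : Prop :=
  ∀ v : TdVertex d, ∀ k : ℕ, ∀ u : Fin k → TdVertex d,
    Function.Injective u → (∀ i, (TdGraph d).Adj v (u i)) →
    ∀ F : Fin k → Finset (TdVertex d), (∀ i, ↑(F i) ⊆ sideOf (u i) v) →
      ∀ y : TdVertex d → M,
        μ (cylEvent ((⋃ i, ↑(F i)) ∪ {v}) y) * (μ (cylEvent {v} y)) ^ (k - 1)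
          = ∏ i : Fin k, μ (cylEvent (↑(F i) ∪ {v}) y)

/-- `X_{S_1}` is a vertex-Markov process on `S_1`: the values at the `d` neighbors of the
root are conditionally independent given the value at the root. -/
def vertexMarkovOnS1 [MeasurableSpace M] (d : ℕ) (μ : Measure (TdVertex d → M)) : Prop :=
  ∀ y : TdVertex d → M,
    μ (cylEvent (SrSet d 1) y) * (μ (cylEvent ({rootTd d} : Set (TdVertex d)) y)) ^ (d - 1)
      = ∏ i ∈ Finset.Icc 1 d,
          μ (cylEvent {v : TdVertex d | v = rootTd d ∨ v.1 = [i]} y)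


/-! ### The randomly labeled rooted colored graph associated to a finite colored graph

Given a finite colored graph `(G,f)` and a vertex `v`, the associated randomly labeled rooted
colored graph is obtained by a breadth-first search exploration of the connected component of
`v` started at `v`, ties between vertices being broken uniformly at random.  We implement the
uniformly random tie-breaking by a uniformly random priority permutation `σ`. -/

variable {M : Type*} {n : ℕ}

/-- The `k`-th layer of the breadth-first search of `G` started at `v`, ordered according to
the position of the parents in the previous layer, ties being broken by the priority `σ`. -/
def bfsLayer (G : SimpleGraph (Fin n)) (v : Fin n) (σ : Equiv.Perm (Fin n)) :
    ℕ → List (Fin n)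
  | 0 => [v]
  | (k + 1) =>
    let prev := bfsLayer G v σ k
    let key : Fin n → ℕ := fun w =>
      (prev.idxOf (((prev.find? (fun u => decide (G.Adj u w))).getD v))) * n + (σ w : ℕ)
    ((List.finRange n).filter
        (fun w => decide (G.Reachable v w ∧ G.dist v w = k + 1))).mergeSort
      (fun a b => key a ≤ key b)

/-- The breadth-first-search label of the vertex `w` lying in layer `k` of the exploration of
`G` started at `v` with tie-breaking priority `σ`. -/
def bfsPathAux (G : SimpleGraph (Fin n)) (v : Fin n) (σ : Equiv.Perm (Fin n)) :
    ℕ → Fin n → Option (List ℕ)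
  | 0, w => if w = v then some [] else none
  | (k + 1), w =>
    match (bfsLayer G v σ k).find? (fun u => decide (G.Adj u w)) with
    | none => none
    | some p =>
      let L := bfsLayer G v σ (k + 1)
      let j := 1 + ((L.takeWhile (fun w' => w' ≠ w)).filter
        (fun w' => (bfsLayer G v σ k).find? (fun u => decide (G.Adj u w')) = some p)).length
      (bfsPathAux G v σ k p).map (fun pl => j :: pl)

/-- The breadth-first-search label of the vertex `w` in the exploration of the connected
component of `v` in `G`, with tie-breaking priority `σ` (`none` if `w` is not in the component
of `v`). -/
def bfsPath (G : SimpleGraph (Fin n)) (v : Fin n) (σ : Equiv.Perm (Fin n)) (w : Fin n) :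
    Option (List ℕ) :=
  if G.Reachable v w then bfsPathAux G v σ (G.dist v w) w else none

/-- The rooted colored graph obtained from the colored graph `(G,f)` by the breadth-first
search exploration of the connected component of `v` rooted at `v`, with tie-breaking
priority `σ`. -/
def bfsRCG (G : SimpleGraph (Fin n)) (f : Fin n → M) (v : Fin n) (σ : Equiv.Perm (Fin n)) :
    RCG M where
  col l := if h : ∃ w, bfsPath G v σ w = some l then some (f h.choose) else none
  adj p :=
    if (∃ w₁ w₂, bfsPath G v σ w₁ = some p.1 ∧ bfsPath G v σ w₂ = some p.2 ∧ G.Adj w₁ w₂)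
    then true else false

/-- `distr_{G,v}(f)`: the law of the randomly labeled rooted colored graph obtained from the
connected component of `v` in the colored graph `(G,f)`, rooted at `v`. -/
def distrAt (G : SimpleGraph (Fin n)) (f : Fin n → M) (v : Fin n) : Measure (RCG M) :=
  ((Nat.factorial n : ℝ≥0∞))⁻¹ •
    ∑ σ : Equiv.Perm (Fin n), Measure.dirac (bfsRCG G f v σ)

/-- `distr_G(f) = (1/|V|) ∑_{v ∈ V} distr_{G,v}(f)`. -/
def distrG (G : SimpleGraph (Fin n)) (f : Fin n → M) : Measure (RCG M) :=
  ((n : ℝ≥0∞))⁻¹ • ∑ v : Fin n, distrAt G f v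

/-! ### Random regular graphs -/

/-- The set `𝓖_n(d)` of simple `d`-regular graphs on the vertex set `{1, …, n}`. -/
def regularGraphs (d n : ℕ) : Set (SimpleGraph (Fin n)) :=
  {G | ∀ v, (G.neighborSet v).ncard = d}

/-- The probability that a uniformly distributed random `d`-regular graph `G_n` on `n`
vertices belongs to `A`. -/
def PrG (d n : ℕ) (A : Set (SimpleGraph (Fin n))) : ℝ :=
  ((regularGraphs d n ∩ A).ncard : ℝ) / ((regularGraphs d n).ncard : ℝ)

/-- The expectation of `F(G_n)` for a uniformly distributed random `d`-regular graph `G_n`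
on `n` vertices. -/
def ExG (d n : ℕ) (F : SimpleGraph (Fin n) → ℝ) : ℝ :=
  (∑ᶠ G ∈ regularGraphs d n, F G) / ((regularGraphs d n).ncard : ℝ)

/-- The integers `n` for which the set of simple `d`-regular graphs on `n` vertices is
non-empty: `n ≥ d + 1` and `nd` even.  Limits `n → ∞` are taken along this set. -/
def goodN (d : ℕ) : Set ℕ := {n | d + 1 ≤ n ∧ Even (n * d)}

/-- The filter `n → ∞` along `{n : n ≥ d+1, nd even}`. -/
def goodFilter (d : ℕ) : Filter ℕ := Filter.atTop ⊓ Filter.principal (goodN d)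

/-! ### The embedding of invariant processes into rooted colored graphs -/

/-- The rooted colored graph `(T_d, x, o)` associated to a coloring `x` of `T_d` (the
canonical labeling of `T_d` is a breadth-first-search labeling; for an invariant process the
resulting law is that of the randomly labeled rooted colored graph). -/
def iotaTd (d : ℕ) (x : TdVertex d → M) : RCG M where
  col l := if h : ValidTd d l then some (x ⟨l, h⟩) else none
  adj p :=
    if (ValidTd d p.1 ∧ ValidTd d p.2 ∧ ((∃ i, p.2 = i :: p.1) ∨ (∃ i, p.1 = i :: p.2)))
    then true else false

/-- The law, as a probability measure on rooted colored graphs, of the randomly labeled rooted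
colored tree `(T_d, X, o)` where `X` has law `μ`. -/
def lawTd (d : ℕ) [MeasurableSpace M] (μ : Measure (TdVertex d → M)) : Measure (RCG M) :=
  μ.map (iotaTd d)

/-! ### Micro-state (sofic) entropy -/

/-- `𝓕_G(μ,r,ε)`: the set of colorings `f` of `G` whose radius-`r` local statistics are
`ε`-close (in the Lévy-Prokhorov distance, which generates the weak topology) to the
radius-`r` restriction of `μ`. -/
def FSet (d : ℕ) [MeasurableSpace M] (μ : Measure (TdVertex d → M)) (r : ℕ) (ε : ℝ)
    (G : SimpleGraph (Fin n)) : Set (Fin n → M) :=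
  {f | levyProkhorovDist ((distrG G f).map (resS r)) ((lawTd d μ).map (resS r)) ≤ ε}

/-- `H_{G}(μ,r,ε) = (1/n) log |𝓕_G(μ,r,ε)| ∈ {-∞} ∪ [0,∞)`. -/
def HG (d : ℕ) [MeasurableSpace M] (μ : Measure (TdVertex d → M)) (r : ℕ) (ε : ℝ)
    (G : SimpleGraph (Fin n)) : EReal :=
  if FSet d μ r ε G = ∅ then ⊥
  else ((Real.log ((FSet d μ r ε G).ncard) / n : ℝ) : EReal)

/-- `h_n(μ,r,ε,α)`: the `α`-quantile
`sup { h ∈ {-∞} ∪ [0,∞) : ℙ(H_{G_n}(μ,r,ε) ≥ h) ≥ α }`. -/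
def hquant (d : ℕ) [MeasurableSpace M] (μ : Measure (TdVertex d → M)) (r : ℕ) (ε : ℝ)
    (α : ℝ) (n : ℕ) : EReal :=
  sSup {h : EReal | (h = ⊥ ∨ 0 ≤ h) ∧
    α ≤ PrG d n {G : SimpleGraph (Fin n) | h ≤ HG d μ r ε G}}

/-- The upper entropy `h̄(μ,r,α) = lim_{ε → 0} limsup_n h_n(μ,r,ε,α)` (the limit over `ε`
of a quantity non-decreasing in `ε`, i.e. the infimum over `ε > 0`). -/
def hbarA (d : ℕ) [MeasurableSpace M] (μ : Measure (TdVertex d → M)) (r : ℕ) (α : ℝ) :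
    EReal :=
  ⨅ ε : {e : ℝ // 0 < e}, (goodFilter d).limsup (fun n => hquant d μ r ε.1 α n)

/-- The lower entropy `h̲(μ,r,α) = lim_{ε → 0} liminf_n h_n(μ,r,ε,α)`. -/
def hlowA (d : ℕ) [MeasurableSpace M] (μ : Measure (TdVertex d → M)) (r : ℕ) (α : ℝ) :
    EReal :=
  ⨅ ε : {e : ℝ // 0 < e}, (goodFilter d).liminf (fun n => hquant d μ r ε.1 α n)

/-- `h̄(μ,r)`: the common value of `h̄(μ,r,α)`, `0 < α < 1`. -/
def hbarR (d : ℕ) [MeasurableSpace M] (μ : Measure (TdVertex d → M)) (r : ℕ) : EReal :=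
  hbarA d μ r (1 / 2)

/-- `h̲(μ,r)`: the common value of `h̲(μ,r,α)`, `0 < α < 1`. -/
def hlowR (d : ℕ) [MeasurableSpace M] (μ : Measure (TdVertex d → M)) (r : ℕ) : EReal :=
  hlowA d μ r (1 / 2)

/-- The upper sofic entropy `h̄(μ) = lim_{r → ∞} h̄(μ,r)` (the limit of a non-increasing
sequence, i.e. the infimum over `r`). -/
def hbar (d : ℕ) [MeasurableSpace M] (μ : Measure (TdVertex d → M)) : EReal :=
  ⨅ r : ℕ, hbarR d μ r

/-- The lower sofic entropy `h̲(μ) = lim_{r → ∞} h̲(μ,r)`. -/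
def hlow (d : ℕ) [MeasurableSpace M] (μ : Measure (TdVertex d → M)) : EReal :=
  ⨅ r : ℕ, hlowR d μ r

/-! ### Typical processes -/

/-- The probability that the random `d`-regular graph `G_n` admits a coloring whose local
statistics are `ε`-close to `μ`. -/
def typicalPr (d : ℕ) [MeasurableSpace M] (μ : Measure (TdVertex d → M)) (ε : ℝ) (n : ℕ) :
    ℝ :=
  PrG d n {G : SimpleGraph (Fin n) |
    ∃ f : Fin n → M, levyProkhorovDist (distrG G f) (lawTd d μ) ≤ ε}

/-- `μ ∈ I_d(M)` is weakly typical if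
`lim_{ε → 0} limsup_{n → ∞} ℙ(∃ f : d(distr_{G_n}(f), μ) ≤ ε) = 1`. -/
def WeaklyTypical (d : ℕ) [MeasurableSpace M] (μ : Measure (TdVertex d → M)) : Prop :=
  Tendsto (fun ε => (goodFilter d).limsup (fun n => typicalPr d μ ε n))
    (nhdsWithin 0 (Set.Ioi 0)) (nhds 1)

/-- `μ ∈ I_d(M)` is strongly typical if
`lim_{ε → 0} lim_{n → ∞} ℙ(∃ f : d(distr_{G_n}(f), μ) ≤ ε) = 1` (in particular the inner
limits along `n → ∞` exist). -/
def StronglyTypical (d : ℕ) [MeasurableSpace M] (μ : Measure (TdVertex d → M)) : Prop :=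
  ∃ L : ℝ → ℝ,
    (∀ ε : ℝ, 0 < ε → Tendsto (fun n => typicalPr d μ ε n) (goodFilter d) (nhds (L ε))) ∧
    Tendsto L (nhdsWithin 0 (Set.Ioi 0)) (nhds 1)


/-! ### Processes on balls of `T_d` and the sets `I_{d,r}(M)`, `I_e(M)` -/

/-- The ball `S_r` of `T_d` as an induced subgraph. -/
def SrGraph (d r : ℕ) : SimpleGraph ↥(SrSet d r) := (TdGraph d).induce (SrSet d r)

/-- The set `E_r` of `T_d` as an induced subgraph. -/
def ErGraph (d r : ℕ) : SimpleGraph ↥(ErSet d r) := (TdGraph d).induce (ErSet d r)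

lemma root_mem_Er (d r : ℕ) (hr : 1 ≤ r) : rootTd d ∈ ErSet d r := by
  left; simpa [rootTd] using hr

lemma node1_mem_Er (d r : ℕ) (hr : 1 ≤ r) : node1 d ∈ ErSet d r := by
  by_cases h : 1 ≤ d
  · right
    constructor <;> simp [node1, h, List.getLast?, hr]
  · simpa [node1, h] using root_mem_Er d r hr

variable {M : Type*}

/-- The restriction to `E_r ⊆ S_r` of a probability measure on `M^{S_r}`. -/
def restrictErOfSr [MeasurableSpace M] (d r : ℕ) (p : Measure (↥(SrSet d r) → M)) :
    Measure (↥(ErSet d r) → M) :=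
  p.map (fun x => fun v : ↥(ErSet d r) => x ⟨v.1, ErSet_subset_SrSet d r v.2⟩)

/-- `I_{d,r}(M)`: the set of probability measures on `M^{S_r}` which are invariant under the
automorphisms of `S_r` and whose restriction to `E_r` is invariant under switching the two
sides of the edge `{o,1}`. -/
def IdrMeas (d r : ℕ) (M : Type*) [MeasurableSpace M] :
    Set (Measure (↥(SrSet d r) → M)) :=
  {p | IsProbabilityMeasure p ∧
    (∀ φ : SrGraph d r ≃g SrGraph d r, p.map (fun x => fun v => x (φ v)) = p) ∧
    (∀ ψ : ErGraph d r ≃g ErGraph d r,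
      (∀ hv : rootTd d ∈ ErSet d r, ((ψ ⟨rootTd d, hv⟩ : ↥(ErSet d r)) : TdVertex d) = node1 d) →
      (restrictErOfSr d r p).map (fun x => fun v => x (ψ v)) = restrictErOfSr d r p)}

/-- The annealed entropy `Σ(p) = H(X_{S_r}) - (d/2) H(X_{E_r})` of `p ∈ I_{d,r}(M)`. -/
def SigmaP [MeasurableSpace M] (d r : ℕ) (p : Measure (↥(SrSet d r) → M)) : ℝ :=
  shannon p - (d / 2 : ℝ) * shannon (restrictErOfSr d r p)

/-- The involution of `E_1 = {o, 1}` switching the two sides of the edge `{o,1}`. -/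
def swapE1 (d : ℕ) : ↥(ErSet d 1) → ↥(ErSet d 1) := fun v =>
  if (v : TdVertex d) = rootTd d then ⟨node1 d, node1_mem_Er d 1 le_rfl⟩
  else ⟨rootTd d, root_mem_Er d 1 le_rfl⟩

/-- `I_e(M)`: the set of probability measures on `M^{E_1}` invariant under switching the two
sides of the edge `{o,1}`. -/
def IeMeas (d : ℕ) (M : Type*) [MeasurableSpace M] : Set (Measure (↥(ErSet d 1) → M)) :=
  {p | IsProbabilityMeasure p ∧ p.map (fun x => fun v => x (swapE1 d v)) = p}

/-- The annealed entropy `Σ(p) = (d/2) H(X_{E_1}) - (d-1) H(X_o)` of `p ∈ I_e(M)`. -/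
def SigmaPe [MeasurableSpace M] (d : ℕ) (p : Measure (↥(ErSet d 1) → M)) : ℝ :=
  (d / 2 : ℝ) * shannon p
    - ((d : ℝ) - 1) * shannon (p.map (fun x => x ⟨rootTd d, root_mem_Er d 1 le_rfl⟩))

/-! ### Factor graphs: functions of rooted unlabeled colored graphs of radius `r` -/

/-- The vertex set of a rooted colored graph. -/
def vertsOf (g : RCG M) : Set (List ℕ) := {l | g.col l ≠ none}

/-- An isomorphism of rooted colored graphs (a color- and adjacency-preserving bijection of
the vertex sets mapping root to root). -/
def RCGRootedIso (g g' : RCG M) : Prop :=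
  ∃ e : ↥(vertsOf g) ≃ ↥(vertsOf g'),
    (∀ v, g'.col ((e v) : List ℕ) = g.col (v : List ℕ)) ∧
    (∀ v w, g'.adj (((e v) : List ℕ), ((e w) : List ℕ)) = g.adj ((v : List ℕ), (w : List ℕ))) ∧
    (∀ h : [] ∈ vertsOf g, ∀ _ : [] ∈ vertsOf g', ((e ⟨[], h⟩) : List ℕ) = [])

/-- A function on rooted unlabeled colored graphs of radius `r`: a function of rooted colored
graphs which only depends on the isomorphism class of the ball of radius `r` around the
root. -/
def IsRadiusRFn (r : ℕ) (ψ : RCG M → ℝ) : Prop :=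
  ∀ g g' : RCG M, RCGRootedIso (resS r g) (resS r g') → ψ g = ψ g'

/-- The value `ψ((G,f,v)_r)` of `ψ` at the rooted unlabeled colored graph given by the ball of
radius `r` around `v` in `(G,f)` (computed as the average over the random labelings, which is
the constant value of `ψ` on them when `ψ` is a function of the unlabeled graph). -/
def psiAt {n : ℕ} (G : SimpleGraph (Fin n)) (f : Fin n → M) (v : Fin n) (ψ : RCG M → ℝ) :
    ℝ :=
  ∫ g, ψ g ∂(distrAt G f v)

/-- The partition function `Z_G = ∑_f ∏_v exp(ψ((G,f,v)_r))` of the factor model `ψ`. -/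
def ZG {n : ℕ} [Fintype M] (G : SimpleGraph (Fin n)) (ψ : RCG M → ℝ) : ℝ :=
  ∑ f : Fin n → M, Real.exp (∑ v : Fin n, psiAt G f v ψ)

/-- The ground-state energy `L_G = max_f ∑_v ψ((G,f,v)_r)`. -/
def LG {n : ℕ} (G : SimpleGraph (Fin n)) (ψ : RCG M → ℝ) : ℝ :=
  sSup {x : ℝ | ∃ f : Fin n → M, x = ∑ v : Fin n, psiAt G f v ψ}

/-- The canonical rooted colored graph associated to a coloring of the ball `S_r` of `T_d`. -/
def iotaSr (d r : ℕ) (x : ↥(SrSet d r) → M) : RCG M where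
  col l := if h : ValidTd d l ∧ l.length ≤ r then some (x ⟨⟨l, h.1⟩, h.2⟩) else none
  adj p := if (ValidTd d p.1 ∧ ValidTd d p.2 ∧ p.1.length ≤ r ∧ p.2.length ≤ r ∧
      ((∃ i, p.2 = i :: p.1) ∨ (∃ i, p.1 = i :: p.2))) then true else false

/-- `⟨p, ψ⟩ = E[ψ(X)]` where `X` has law `p ∈ I_{d,r}(M)`. -/
def pairing [MeasurableSpace M] (d r : ℕ) (p : Measure (↥(SrSet d r) → M))
    (ψ : RCG M → ℝ) : ℝ :=
  ∫ x, ψ (iotaSr d r x) ∂p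

/-! ### Annealed quantities for random regular graphs -/

/-- `log` with the convention `log 0 = -∞`, with values in the extended reals. -/
def elog (x : ℝ) : EReal := if x ≤ 0 then ⊥ else ((Real.log x : ℝ) : EReal)

/-- The set `𝓖_n(μ,r,ε)` of pairs `(G,f)` of a `d`-regular graph together with a coloring
whose radius-`r` local statistics are `ε`-close to `μ_r`. -/
def GnPairs (d : ℕ) [MeasurableSpace M] (μ : Measure (TdVertex d → M)) (r : ℕ) (ε : ℝ)
    (n : ℕ) : Set (SimpleGraph (Fin n) × (Fin n → M)) :=
  {Gf | Gf.1 ∈ regularGraphs d n ∧ Gf.2 ∈ FSet d μ r ε Gf.1}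

/-- The annealed entropy
`Σ_n(μ,r,ε) = (1/n) (log |𝓖_n(μ,r,ε)| - log |𝓖_n(d)|) = (1/n) log E |𝓕_{G_n}(μ,r,ε)|`. -/
def SigmaN (d : ℕ) [MeasurableSpace M] (μ : Measure (TdVertex d → M)) (r : ℕ) (ε : ℝ)
    (n : ℕ) : EReal :=
  (((n : ℝ)⁻¹ : ℝ) : EReal) *
    elog (((GnPairs d μ r ε n).ncard : ℝ) / ((regularGraphs d n).ncard : ℝ))

/-- The relaxed partition function `Z_G(β) = ∑_f exp(-nβ d(distr_G(f)_r, μ_r))`. -/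
def ZGbeta (d : ℕ) [MeasurableSpace M] {n : ℕ} [Fintype M] (μ : Measure (TdVertex d → M))
    (r : ℕ) (β : ℝ) (G : SimpleGraph (Fin n)) : ℝ :=
  ∑ f : Fin n → M, Real.exp (-(n : ℝ) * β *
    levyProkhorovDist ((distrG G f).map (resS r)) ((lawTd d μ).map (resS r)))


/-! ### Processes on unimodular Galton-Watson trees

A colored rooted tree `(T, X, o)` with `T` a subtree of the label set, rooted at `[]` and
with the children of a vertex `v` labeled `1 :: v, …, N_v :: v`, is encoded as a rooted
colored graph in `RCG M`. -/

/-- `g` is a canonically labeled colored rooted tree. -/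
def IsCanonTree (g : RCG M) : Prop :=
  g.col [] ≠ none ∧
  (∀ l : List ℕ, g.col l ≠ none → g.col l.tail ≠ none) ∧
  (∀ (v : List ℕ) (i : ℕ), 1 ≤ i → g.col ((i + 1) :: v) ≠ none → g.col (i :: v) ≠ none) ∧
  (∀ v : List ℕ, g.col (0 :: v) = none) ∧
  (∀ p : List ℕ × List ℕ, g.adj p = true ↔
    (g.col p.1 ≠ none ∧ g.col p.2 ≠ none ∧
      ((∃ i, p.2 = i :: p.1) ∨ (∃ i, p.1 = i :: p.2))))

/-- A finite canonically labeled tree. -/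
def IsFinTree (t : Finset (List ℕ)) : Prop :=
  [] ∈ t ∧ (∀ l ∈ t, l.tail ∈ t) ∧
  (∀ (v : List ℕ) (i : ℕ), 1 ≤ i → ((i + 1) :: v) ∈ t → (i :: v) ∈ t) ∧
  (∀ v : List ℕ, (0 :: v) ∉ t)

/-- The number of children of the vertex `v` in the finite tree `t`. -/
def childCountF (t : Finset (List ℕ)) (v : List ℕ) : ℕ :=
  (t.filter (fun w => w ≠ [] ∧ w.tail = v)).card

/-- The size-biased version `π̂(k) = (k+1) π(k+1) / d` of the offspring distribution `π`. -/
def sizeBiased (π : ℕ → ℝ) (dd : ℝ) (k : ℕ) : ℝ := (k + 1 : ℝ) * π (k + 1) / dd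

/-- The probability that the unimodular Galton-Watson tree with degree distribution `π`,
truncated at depth `k`, equals the finite tree `t`. -/
def treeWeight (π : ℕ → ℝ) (dd : ℝ) (k : ℕ) (t : Finset (List ℕ)) : ℝ :=
  π (childCountF t []) *
    ∏ v ∈ t.filter (fun v => v ≠ [] ∧ v.length < k), sizeBiased π dd (childCountF t v)

/-- The law of the underlying tree is the unimodular Galton-Watson law `UGW(π)`:
all finite-depth truncations have the prescribed distribution. -/
def IsUGWTreeLaw (π : ℕ → ℝ) (dd : ℝ) (μ : Measure (RCG M)) : Prop :=
  ∀ (k : ℕ) (t : Finset (List ℕ)), IsFinTree t → (∀ v ∈ t, v.length ≤ k) →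
    (μ {g | ∀ l : List ℕ, l.length ≤ k → (g.col l ≠ none ↔ l ∈ t)}).toReal
      = treeWeight π dd k t

/-- `e` realizes an isomorphism (not necessarily root-preserving) of the colored graphs `g`
and `g'`. -/
def IsIsoVia (g g' : RCG M) (e : List ℕ → List ℕ) : Prop :=
  Set.BijOn e (vertsOf g) (vertsOf g') ∧
  (∀ l ∈ vertsOf g, g'.col (e l) = g.col l) ∧
  (∀ l ∈ vertsOf g, ∀ l' ∈ vertsOf g, g'.adj (e l, e l') = g.adj (l, l'))

/-- A function on doubly rooted colored graphs, invariant under isomorphisms. -/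
def PairInvariant (F : RCG M → List ℕ → List ℕ → ℝ≥0∞) : Prop :=
  ∀ g g' e, IsIsoVia g g' e → ∀ u ∈ vertsOf g, ∀ v ∈ vertsOf g, F g' (e u) (e v) = F g u v

/-- Unimodularity (the mass-transport principle):
`E ∑_v F(G,o,v) = E ∑_v F(G,v,o)` for all isomorphism-invariant `F ≥ 0`. -/
def Unimodular (μ : Measure (RCG M)) : Prop :=
  ∀ F : RCG M → List ℕ → List ℕ → ℝ≥0∞, PairInvariant F →
    ∫⁻ g, (∑' v : ↥(vertsOf g), F g [] (v : List ℕ)) ∂μ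
      = ∫⁻ g, (∑' v : ↥(vertsOf g), F g (v : List ℕ) []) ∂μ

/-- `I_π(M)`: the laws of invariant (unimodular) processes `(T,X)` with colors in `M` over
the unimodular Galton-Watson tree with degree distribution `π` (of mean `dd`). -/
def IPiMeas (π : ℕ → ℝ) (dd : ℝ) (M : Type*) [MeasurableSpace M] :
    Set (Measure (RCG M)) :=
  {μ | IsProbabilityMeasure μ ∧ μ {g | IsCanonTree g} = 1 ∧ Unimodular μ ∧
    IsUGWTreeLaw π dd μ}

/-- The root degree `deg(o)` of a canonically labeled tree (the number of children of the
root). -/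
def rootDeg (g : RCG M) : ℕ := {i : ℕ | g.col [i] ≠ none}.ncard

/-- The edge-biased law `→μ(⬝) = (1/d) E[deg(o) 1{(T,X,(o,1)) ∈ ⬝}]` on colored edge-rooted
trees (the root edge being `([], [1])`). -/
def vecLaw (dd : ℝ) [MeasurableSpace M] (μ : Measure (RCG M)) : Measure (RCG M) :=
  (ENNReal.ofReal dd)⁻¹ • μ.withDensity (fun g => (rootDeg g : ℝ≥0∞))

/-- Membership in `E_r = B_{r-1}({o,1})` for a vertex of a canonically labeled tree. -/
def inErL (r : ℕ) (l : List ℕ) : Prop :=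
  l.length + 1 ≤ r ∨ (l.getLast? = some 1 ∧ l.length ≤ r)

/-- The restriction of a colored edge-rooted tree to `E_r = B_{r-1}({o,1})`. -/
def resE (r : ℕ) (g : RCG M) : RCG M where
  col l := if inErL r l then g.col l else none
  adj p := if inErL r p.1 ∧ inErL r p.2 then g.adj p else false

/-- The Shannon entropy `H(π)` of the probability mass function `π`. -/
def Hpmf (π : ℕ → ℝ) : ℝ := ∑' k : ℕ, Real.negMulLog (π k)

/-- The annealed entropy `Σ_r(μ) = H(X_{S_r}) - (d/2) H(→X_{E_r}) - H(π)` of an invariant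
process over the unimodular Galton-Watson tree. -/
def SigmaUGW (π : ℕ → ℝ) (dd : ℝ) [MeasurableSpace M] (r : ℕ) (μ : Measure (RCG M)) : ℝ :=
  shannon (μ.map (resS r)) - (dd / 2) * shannon ((vecLaw dd μ).map (resE r)) - Hpmf π

/-- `Σ(μ) = lim_{r → ∞} Σ_r(μ)` (the limit of a non-increasing sequence). -/
def SigmaUGWInf (π : ℕ → ℝ) (dd : ℝ) [MeasurableSpace M] (μ : Measure (RCG M)) : EReal :=
  ⨅ r : ℕ, ((SigmaUGW π dd (r + 1) μ : ℝ) : EReal)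

/-- `Σ_e(X) = (d/2) H(→X_{E_1}) - d H(→X_o) + H(X_o) - H(π)`. -/
def SigmaEUGW (π : ℕ → ℝ) (dd : ℝ) [MeasurableSpace M] (μ : Measure (RCG M)) : ℝ :=
  (dd / 2) * shannon ((vecLaw dd μ).map (resE 1))
    - dd * shannon ((vecLaw dd μ).map (resS 0))
    + shannon (μ.map (resS 0)) - Hpmf π

/-! ### Markov processes on random trees -/

/-- The side of the (potential) edge `{u,w}` containing `u`, among the labels. -/
def sideL (u w : List ℕ) : Set (List ℕ) := {v | treeDist v u < treeDist v w}

/-- `B_{r-1}({u,w})` among the labels. -/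
def edgeBallL (r : ℕ) (u w : List ℕ) : Set (List ℕ) :=
  {v | treeDist v u + 1 ≤ r ∨ treeDist v w + 1 ≤ r}

/-- The event that the tree structure agrees with that of `y` on `S` and that the colored
tree agrees with `y` on `B`. -/
def treeCylEvent (S B : Set (List ℕ)) (y : RCG M) : Set (RCG M) :=
  {g | (∀ l ∈ S, (g.col l ≠ none ↔ y.col l ≠ none)) ∧ (∀ l ∈ B, g.col l = y.col l)}

/-- A random colored tree is `r`-Markov on the ambient set `A` if, conditioned on the tree
and on the value on the `(r-1)`-neighborhood of an edge, the processes on the two sides of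
the edge are independent (conditioning on the tree is expressed through arbitrary finite
windows `S`). -/
def rMarkovTreeOn [MeasurableSpace M] (r : ℕ) (A : Set (List ℕ)) (μ : Measure (RCG M)) :
    Prop :=
  ∀ (u : List ℕ) (i : ℕ), 1 ≤ i → u ∈ A → (i :: u) ∈ A →
    ∀ F₁ F₂ : Finset (List ℕ), ↑F₁ ⊆ sideL u (i :: u) ∩ A → ↑F₂ ⊆ sideL (i :: u) u ∩ A →
    ∀ S : Finset (List ℕ), ↑S ⊆ A → ∀ y : RCG M,
      μ (treeCylEvent ↑S (edgeBallL r u (i :: u) ∩ A) y ∩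
          treeCylEvent ∅ ↑F₁ y ∩ treeCylEvent ∅ ↑F₂ y)
        * μ (treeCylEvent ↑S (edgeBallL r u (i :: u) ∩ A) y)
      = μ (treeCylEvent ↑S (edgeBallL r u (i :: u) ∩ A) y ∩ treeCylEvent ∅ ↑F₁ y)
        * μ (treeCylEvent ↑S (edgeBallL r u (i :: u) ∩ A) y ∩ treeCylEvent ∅ ↑F₂ y)

/-- A random colored tree is `r`-Markov if the above holds with ambient set everything. -/
def rMarkovTree [MeasurableSpace M] (r : ℕ) (μ : Measure (RCG M)) : Prop :=
  rMarkovTreeOn r Set.univ μ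

/-- A random colored tree is vertex-Markov on the ambient set `A` if, conditioned on the tree
and on the value at a vertex, the processes on the pending subtrees of that vertex are
independent. -/
def vertexMarkovTreeOn [MeasurableSpace M] (A : Set (List ℕ)) (μ : Measure (RCG M)) :
    Prop :=
  ∀ v ∈ A, ∀ (k : ℕ) (u : Fin k → List ℕ), Function.Injective u →
    (∀ j, u j ∈ A ∧ ((∃ i, 1 ≤ i ∧ u j = i :: v) ∨ (v ≠ [] ∧ u j = v.tail))) →
    ∀ F : Fin k → Finset (List ℕ), (∀ j, ↑(F j) ⊆ sideL (u j) v ∩ A) →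
    ∀ S : Finset (List ℕ), ↑S ⊆ A → ∀ y : RCG M,
      μ (treeCylEvent ↑S {v} y ∩ ⋂ j, treeCylEvent ∅ ↑(F j) y)
          * (μ (treeCylEvent ↑S {v} y)) ^ (k - 1)
        = ∏ j : Fin k, μ (treeCylEvent ↑S {v} y ∩ treeCylEvent ∅ ↑(F j) y)

/-- A random colored tree is vertex-Markov if the above holds with ambient set everything. -/
def vertexMarkovTree [MeasurableSpace M] (μ : Measure (RCG M)) : Prop :=
  vertexMarkovTreeOn Set.univ μ

/-! ### Random graphs with given degree sequences -/

/-- The set of simple graphs on `{1,…,n}` with degree sequence `dn`. -/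
def degSeqGraphs (n : ℕ) (dn : Fin n → ℕ) : Set (SimpleGraph (Fin n)) :=
  {G | ∀ v, (G.neighborSet v).ncard = dn v}

/-- The probability that a uniform random graph with degree sequence `dn` lies in `A`. -/
def PrD (n : ℕ) (dn : Fin n → ℕ) (A : Set (SimpleGraph (Fin n))) : ℝ :=
  ((degSeqGraphs n dn ∩ A).ncard : ℝ) / ((degSeqGraphs n dn).ncard : ℝ)

/-- `𝓕_G(μ,r,ε)` for a process `μ` over a unimodular Galton-Watson tree. -/
def FSetD [MeasurableSpace M] (μ : Measure (RCG M)) (r : ℕ) (ε : ℝ) {n : ℕ}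
    (G : SimpleGraph (Fin n)) : Set (Fin n → M) :=
  {f | levyProkhorovDist ((distrG G f).map (resS r)) (μ.map (resS r)) ≤ ε}

/-- `H_G(μ,r,ε) = (1/n) log |𝓕_G(μ,r,ε)|`. -/
def HGD [MeasurableSpace M] (μ : Measure (RCG M)) (r : ℕ) (ε : ℝ) {n : ℕ}
    (G : SimpleGraph (Fin n)) : EReal :=
  if FSetD μ r ε G = ∅ then ⊥
  else ((Real.log ((FSetD μ r ε G).ncard) / n : ℝ) : EReal)

/-- The `α`-quantile of `H_{G_n}(μ,r,ε)` for the uniform random graph with degree sequence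
`DN n`. -/
def hquantD [MeasurableSpace M] (DN : (n : ℕ) → Fin n → ℕ) (μ : Measure (RCG M)) (r : ℕ)
    (ε : ℝ) (α : ℝ) (n : ℕ) : EReal :=
  sSup {h : EReal | (h = ⊥ ∨ 0 ≤ h) ∧
    α ≤ PrD n (DN n) {G : SimpleGraph (Fin n) | h ≤ HGD μ r ε G}}

/-- `h̄(μ,r,α)` for the degree-sequence ensemble. -/
def hbarAD [MeasurableSpace M] (DN : (n : ℕ) → Fin n → ℕ) (μ : Measure (RCG M)) (r : ℕ)
    (α : ℝ) : EReal :=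
  ⨅ ε : {e : ℝ // 0 < e}, Filter.atTop.limsup (fun n => hquantD DN μ r ε.1 α n)

/-- `h̲(μ,r,α)` for the degree-sequence ensemble. -/
def hlowAD [MeasurableSpace M] (DN : (n : ℕ) → Fin n → ℕ) (μ : Measure (RCG M)) (r : ℕ)
    (α : ℝ) : EReal :=
  ⨅ ε : {e : ℝ // 0 < e}, Filter.atTop.liminf (fun n => hquantD DN μ r ε.1 α n)

/-- `h̄(μ,r)`: the common value of `h̄(μ,r,α)`, `0 < α < 1`. -/
def hbarRD [MeasurableSpace M] (DN : (n : ℕ) → Fin n → ℕ) (μ : Measure (RCG M)) (r : ℕ) :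
    EReal :=
  hbarAD DN μ r (1 / 2)

/-- `h̲(μ,r)`. -/
def hlowRD [MeasurableSpace M] (DN : (n : ℕ) → Fin n → ℕ) (μ : Measure (RCG M)) (r : ℕ) :
    EReal :=
  hlowAD DN μ r (1 / 2)

/-- The upper sofic entropy `h̄(μ) = lim_{r → ∞} h̄(μ,r)`. -/
def hbarD [MeasurableSpace M] (DN : (n : ℕ) → Fin n → ℕ) (μ : Measure (RCG M)) : EReal :=
  ⨅ r : ℕ, hbarRD DN μ r

/-- The lower sofic entropy `h̲(μ) = lim_{r → ∞} h̲(μ,r)`. -/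
def hlowD [MeasurableSpace M] (DN : (n : ℕ) → Fin n → ℕ) (μ : Measure (RCG M)) : EReal :=
  ⨅ r : ℕ, hlowRD DN μ r

/-- The hypotheses on the degree sequences: uniformly bounded by `Δ`, even sums, and
empirical distributions converging (weakly) to `π`. -/
def GoodDegSeq (π : ℕ → ℝ) (Δ : ℝ) (DN : (n : ℕ) → Fin n → ℕ) : Prop :=
  (∀ n v, (DN n v : ℝ) ≤ Δ) ∧ (∀ n, Even (∑ v : Fin n, DN n v)) ∧
  (∀ k : ℕ, Tendsto (fun n => (((Finset.univ.filter (fun v : Fin n => DN n v = k)).card : ℝ) / n))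
    atTop (nhds (π k)))

/-- The hypotheses on the degree distribution `π`: a probability mass function supported in
`{0,…,Δ}` with mean `dd > 0`. -/
def GoodPmf (π : ℕ → ℝ) (Δ : ℝ) (dd : ℝ) : Prop :=
  (∀ k, 0 ≤ π k) ∧ (∑' k : ℕ, π k) = 1 ∧ (∀ k : ℕ, (Δ : ℝ) < k → π k = 0) ∧
  (∑' k : ℕ, (k : ℝ) * π k) = dd ∧ 0 < dd


/-! ### Couplings -/

/-- `ν ∈ I_d(M × M)` is an invariant coupling of `μ` with itself: both coordinate marginal
processes of `ν` have law `μ`. -/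
def IsInvCoupling (d : ℕ) {M : Type*} [MeasurableSpace M] (μ : Measure (TdVertex d → M))
    (ν : Measure (TdVertex d → M × M)) : Prop :=
  ν ∈ InvMeas d (M × M) ∧ ν.map (fun x => fun v => (x v).1) = μ ∧
    ν.map (fun x => fun v => (x v).2) = μ

/-- The first coordinate marginal of a colored graph with colors in a product set. -/
def rcgFst {M₁ M₂ : Type*} (g : RCG (M₁ × M₂)) : RCG M₁ :=
  ⟨fun l => (g.col l).map Prod.fst, g.adj⟩

/-- The second coordinate marginal of a colored graph with colors in a product set. -/
def rcgSnd {M₁ M₂ : Type*} (g : RCG (M₁ × M₂)) : RCG M₂ :=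
  ⟨fun l => (g.col l).map Prod.snd, g.adj⟩

/-- `ν ∈ I_π(M × M)` is an invariant coupling of `μ ∈ I_π(M)` with itself. -/
def IsInvCouplingUGW (π : ℕ → ℝ) (dd : ℝ) {M : Type*} [MeasurableSpace M]
    (μ : Measure (RCG M)) (ν : Measure (RCG (M × M))) : Prop :=
  ν ∈ IPiMeas π dd (M × M) ∧ ν.map rcgFst = μ ∧ ν.map rcgSnd = μ

/-! ### Entropy of finite families of random variables -/

/-- The total weight of the configurations which agree with `z` on `S`. -/
def marginal {ι α : Type*} [Fintype (ι → α)] (p : (ι → α) → ℝ) (S : Set ι) (z : ι → α) : ℝ :=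
  ∑ z', if Set.EqOn z' z S then p z' else 0

/-- The entropy of the restriction to `S` of a random configuration with weights `p`. -/
def entropyOn {ι α : Type*} [Fintype (ι → α)] (p : (ι → α) → ℝ) (S : Set ι) : ℝ :=
  ∑ z, p z * -Real.log (marginal p S z)

section Marginal

variable {ι α : Type*} [Fintype (ι → α)] {p : (ι → α) → ℝ}

lemma marginal_nonneg (hp : ∀ z, 0 ≤ p z) (S : Set ι) (z : ι → α) : 0 ≤ marginal p S z :=
  Finset.sum_nonneg fun z' _ => by split_ifs <;> simp [hp]

lemma le_marginal (hp : ∀ z, 0 ≤ p z) (S : Set ι) (z : ι → α) : p z ≤ marginal p S z := by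
  have h := Finset.single_le_sum (f := fun z' => if Set.EqOn z' z S then p z' else 0)
    (fun z' _ => by split_ifs <;> simp [hp]) (Finset.mem_univ z)
  simpa [marginal, Set.eqOn_refl] using h

lemma marginal_congr {S : Set ι} {z z' : ι → α} (h : Set.EqOn z z' S) :
    marginal p S z = marginal p S z' :=
  Finset.sum_congr rfl fun _ _ => if_congr ⟨fun h' => h'.trans h, fun h' => h'.trans h.symm⟩ rfl rfl

lemma marginal_anti (hp : ∀ z, 0 ≤ p z) {S T : Set ι} (h : S ⊆ T) (z : ι → α) :
    marginal p T z ≤ marginal p S z :=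
  Finset.sum_le_sum fun z' _ => by
    split_ifs with h₁ h₂
    · exact le_rfl
    · exact absurd (h₁.mono h) h₂
    · exact hp z'
    · exact le_rfl

lemma marginal_univ (z : ι → α) : marginal p Set.univ z = p z := by
  simp [marginal, Set.eqOn_univ]

/-- Two configurations have at most one common gluing, and only if they agree on the overlap. -/
lemma sum_gluing_le {S T : Set ι} (hST : S ∪ T = Set.univ) (a b : ι → α) :
    (∑ z : ι → α, if Set.EqOn a z S ∧ Set.EqOn b z T then (1 : ℝ) else 0) ≤
      if Set.EqOn b a (S ∩ T) then 1 else 0 := by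
  by_cases hex : ∃ z, Set.EqOn a z S ∧ Set.EqOn b z T
  · obtain ⟨z, hz⟩ := hex
    rw [if_pos ((hz.2.mono Set.inter_subset_right).trans (hz.1.mono Set.inter_subset_left).symm),
      Finset.sum_eq_single z]
    · rw [if_pos hz]
    · intro w _ hne
      refine if_neg fun hw => hne ?_
      funext v
      rcases (hST ▸ Set.mem_univ v : v ∈ S ∪ T) with hv | hv
      · exact (hw.1 hv).symm.trans (hz.1 hv)
      · exact (hw.2 hv).symm.trans (hz.2 hv)
    · simp
  · rw [Finset.sum_eq_zero fun z _ => if_neg fun h => hex ⟨z, h⟩]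
    split_ifs <;> simp

/-- The conditionally independent coupling of two marginals has total mass at most one. -/
lemma sum_marginal_mul_div_le (hp : ∀ z, 0 ≤ p z) {S T : Set ι} (hST : S ∪ T = Set.univ) :
    ∑ z, marginal p S z * marginal p T z / marginal p (S ∩ T) z ≤ ∑ z, p z := by
  have expand : ∀ z, marginal p S z * marginal p T z / marginal p (S ∩ T) z =
      ∑ a, ∑ b, p a / marginal p (S ∩ T) a * p b *
        if Set.EqOn a z S ∧ Set.EqOn b z T then 1 else 0 := by
    intro z
    rw [marginal, marginal, Finset.sum_mul_sum, Finset.sum_div]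
    refine Finset.sum_congr rfl fun a _ => ?_
    rw [Finset.sum_div]
    refine Finset.sum_congr rfl fun b _ => ?_
    by_cases ha : Set.EqOn a z S
    · rw [marginal_congr (ha.mono Set.inter_subset_left)]
      by_cases hb : Set.EqOn b z T <;> simp [ha, hb]
      ring
    · simp [ha]
  calc ∑ z, marginal p S z * marginal p T z / marginal p (S ∩ T) z
      = ∑ a, ∑ b, p a / marginal p (S ∩ T) a * p b *
          ∑ z, if Set.EqOn a z S ∧ Set.EqOn b z T then 1 else 0 := by
        simp_rw [expand, Finset.mul_sum]
        rw [Finset.sum_comm]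
        exact Finset.sum_congr rfl fun a _ => Finset.sum_comm
    _ ≤ ∑ a, ∑ b, p a / marginal p (S ∩ T) a * p b *
          if Set.EqOn b a (S ∩ T) then 1 else 0 := by
        refine Finset.sum_le_sum fun a _ => Finset.sum_le_sum fun b _ => ?_
        exact mul_le_mul_of_nonneg_left (sum_gluing_le hST a b)
          (mul_nonneg (div_nonneg (hp a) (marginal_nonneg hp _ _)) (hp b))
    _ = ∑ a, p a / marginal p (S ∩ T) a * marginal p (S ∩ T) a := by
        refine Finset.sum_congr rfl fun a _ => ?_
        nth_rewrite 3 [marginal]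
        rw [Finset.mul_sum]
        refine Finset.sum_congr rfl fun b _ => ?_
        split_ifs <;> simp
    _ ≤ ∑ a, p a := by
        refine Finset.sum_le_sum fun a _ => ?_
        by_cases h : marginal p (S ∩ T) a = 0
        · simp [h, hp]
        · rw [div_mul_cancel₀ _ h]

/-- Submodularity of entropy, with the case of equality. -/
lemma entropyOn_submodular (hp : ∀ z, 0 ≤ p z) {S T : Set ι} (hST : S ∪ T = Set.univ) :
    entropyOn p Set.univ + entropyOn p (S ∩ T) ≤ entropyOn p S + entropyOn p T ∧
    (entropyOn p Set.univ + entropyOn p (S ∩ T) = entropyOn p S + entropyOn p T ↔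
      ∀ z, p z * marginal p (S ∩ T) z = marginal p S z * marginal p T z) := by
  set I := S ∩ T
  set L : (ι → α) → ℝ := fun z => p z * (Real.log (marginal p S z) + Real.log (marginal p T z)
    - Real.log (p z) - Real.log (marginal p I z)) with hL
  have hsum : ∑ z, L z = entropyOn p Set.univ + entropyOn p I - entropyOn p S - entropyOn p T := by
    simp only [entropyOn, marginal_univ, ← Finset.sum_add_distrib, ← Finset.sum_sub_distrib]
    exact Finset.sum_congr rfl fun z _ => by simp only [hL]; ring
  have hpos : ∀ z, 0 < p z → 0 < marginal p S z ∧ 0 < marginal p T z ∧ 0 < marginal p I z :=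
    fun z hz => ⟨hz.trans_le (le_marginal hp _ _), hz.trans_le (le_marginal hp _ _),
      hz.trans_le (le_marginal hp _ _)⟩
  have hlog : ∀ z, 0 < p z → L z =
      p z * Real.log (marginal p S z * marginal p T z / (p z * marginal p I z)) := by
    intro z hz
    obtain ⟨h₁, h₂, h₃⟩ := hpos z hz
    rw [Real.log_div (by positivity) (by positivity), Real.log_mul h₁.ne' h₂.ne',
      Real.log_mul hz.ne' h₃.ne']
    simp only [hL]; ring
  have hquot : ∀ z, 0 < p z →
      p z * (marginal p S z * marginal p T z / (p z * marginal p I z) - 1) =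
        marginal p S z * marginal p T z / marginal p I z - p z := by
    intro z hz
    obtain ⟨h₁, h₂, h₃⟩ := hpos z hz
    field_simp
  have hle : ∀ z, L z ≤ marginal p S z * marginal p T z / marginal p I z - p z := by
    intro z
    rcases (hp z).eq_or_lt with hz | hz
    · simp only [hL, ← hz, zero_mul, sub_zero]
      exact div_nonneg (mul_nonneg (marginal_nonneg hp _ _) (marginal_nonneg hp _ _))
        (marginal_nonneg hp _ _)
    · obtain ⟨h₁, h₂, h₃⟩ := hpos z hz
      rw [hlog z hz, ← hquot z hz]
      exact mul_le_mul_of_nonneg_left (Real.log_le_sub_one_of_pos (by positivity)) hz.le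
  have htot : ∑ z, (marginal p S z * marginal p T z / marginal p I z - p z) ≤ 0 := by
    rw [Finset.sum_sub_distrib]
    linarith [sum_marginal_mul_div_le hp hST]
  have hmain := Finset.sum_le_sum fun z (_ : z ∈ Finset.univ) => hle z
  refine ⟨by linarith, fun h => ?_, fun h => ?_⟩
  · have heq : ∀ z ∈ Finset.univ, L z =
        marginal p S z * marginal p T z / marginal p I z - p z :=
      (Finset.sum_eq_sum_iff_of_le fun z _ => hle z).1 (by linarith)
    intro z
    have hz := heq z (Finset.mem_univ z)
    rcases (hp z).eq_or_lt with h0 | h0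
    · simp only [hL, ← h0, zero_mul, sub_zero] at hz ⊢
      rcases (marginal_nonneg hp I z).eq_or_lt with hI | hI
      · have hS := marginal_anti hp (Set.inter_subset_left : I ⊆ S) z
        have := marginal_nonneg hp S z
        rw [show marginal p S z = 0 by linarith, zero_mul]
      · rw [eq_comm, div_eq_zero_iff] at hz
        exact (hz.resolve_right hI.ne').symm
    · obtain ⟨h₁, h₂, h₃⟩ := hpos z h0
      rw [hlog z h0, ← hquot z h0] at hz
      by_contra hne
      refine (Real.log_lt_sub_one_of_pos (by positivity) fun h1 => hne ?_).ne
        (mul_left_cancel₀ h0.ne' hz)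
      rw [div_eq_one_iff_eq (by positivity)] at h1
      exact h1.symm
  · have : ∑ z, L z = 0 := by
      refine Finset.sum_eq_zero fun z _ => ?_
      rcases (hp z).eq_or_lt with h0 | h0
      · simp [hL, ← h0]
      · obtain ⟨h₁, h₂, h₃⟩ := hpos z h0
        rw [hlog z h0, ← h z, div_self (by positivity), Real.log_one, mul_zero]
    linarith

end Marginal
/-! ### Entropy of the restrictions of a process -/

lemma measureReal_eq_sum_ite {α : Type*} [Fintype α] [MeasurableSpace α]
    [MeasurableSingletonClass α] (ν : Measure α) [IsFiniteMeasure ν] (A : Set α) :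
    ν.real A = ∑ z, if z ∈ A then ν.real {z} else 0 := by
  rw [← Finset.sum_filter, sum_measureReal_singleton]
  simp

lemma measurable_restrict {M : Type*} [MeasurableSpace M] (S : Set (TdVertex d)) :
    Measurable (fun (x : TdVertex d → M) (v : ↥S) => x v.1) :=
  measurable_pi_lambda _ fun v => measurable_pi_apply v.1

section Restriction

variable {M : Type*} [Fintype M] [MeasurableSpace M] [DiscreteMeasurableSpace M]
  (μ : Measure (TdVertex d → M)) [IsProbabilityMeasure μ]

instance (S : Set (TdVertex d)) : IsProbabilityMeasure (restrictTo S μ) :=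
  Measure.isProbabilityMeasure_map (measurable_restrict S).aemeasurable

lemma measureReal_cylEvent_eq_marginal {U S : Set (TdVertex d)} [Fintype (↥U → M)]
    (hU : U.Finite) (hS : S ⊆ U) (y : TdVertex d → M) :
    μ.real (cylEvent S y) =
      marginal (fun z => (restrictTo U μ).real {z}) (Subtype.val ⁻¹' S) (fun v : ↥U => y v.1) := by
  have : Finite ↥U := hU
  have hcyl : cylEvent S y = (fun (x : TdVertex d → M) (v : ↥U) => x v.1) ⁻¹'
      {z | Set.EqOn z (fun v : ↥U => y v.1) (Subtype.val ⁻¹' S)} := by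
    ext x
    exact ⟨fun h v hv => h v.1 hv, fun h v hv => h (x := ⟨v, hS hv⟩) hv⟩
  rw [hcyl, ← map_measureReal_apply (measurable_restrict U) (Set.toFinite _).measurableSet]
  exact measureReal_eq_sum_ite (restrictTo U μ) _

lemma shannon_restrictTo_eq_entropyOn {U S : Set (TdVertex d)} [Fintype (↥U → M)]
    (hU : U.Finite) (hS : S ⊆ U) :
    shannon (restrictTo S μ) =
      entropyOn (fun z => (restrictTo U μ).real {z}) (Subtype.val ⁻¹' S) := by
  have : Finite ↥U := hU
  have : Finite ↥S := hU.subset hS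
  have : Fintype (↥S → M) := Fintype.ofFinite _
  set ρ : (↥U → M) → ↥S → M := fun z v => z ⟨v.1, hS v.2⟩ with hρ
  have hρm : Measurable ρ := measurable_pi_lambda _ fun v => measurable_pi_apply _
  have hcomp : restrictTo S μ = (restrictTo U μ).map ρ :=
    (Measure.map_map hρm (measurable_restrict U)).symm
  have hsingle : ∀ a, (restrictTo S μ).real {a} =
      ∑ z, if ρ z = a then (restrictTo U μ).real {z} else 0 := by
    intro a
    rw [hcomp, map_measureReal_apply hρm (measurableSet_singleton a), measureReal_eq_sum_ite]
    rfl
  have hmarg : ∀ z, (restrictTo S μ).real {ρ z} =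
      marginal (fun z => (restrictTo U μ).real {z}) (Subtype.val ⁻¹' S) z := by
    intro z
    rw [hsingle]
    refine Finset.sum_congr rfl fun w _ => if_congr ⟨fun h v hv => ?_, fun h => ?_⟩ rfl rfl
    · exact congrFun h ⟨v.1, hv⟩
    · exact funext fun v => h (x := ⟨v.1, hS v.2⟩) v.2
  calc shannon (restrictTo S μ)
      = ∑ a, ∑ z, if ρ z = a then
          (restrictTo U μ).real {z} * -Real.log ((restrictTo S μ).real {a}) else 0 := by
        rw [shannon, tsum_fintype]
        refine Finset.sum_congr rfl fun a _ => ?_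
        change -(restrictTo S μ).real {a} * Real.log ((restrictTo S μ).real {a}) = _
        nth_rewrite 1 [hsingle]
        rw [neg_mul_comm, Finset.sum_mul]
        exact Finset.sum_congr rfl fun z _ => by split_ifs <;> simp
    _ = _ := by
        rw [Finset.sum_comm]
        refine Finset.sum_congr rfl fun z _ => ?_
        rw [Finset.sum_ite_eq, if_pos (Finset.mem_univ _), hmarg]

/-- Submodularity of the entropies of the restrictions of a process; the case of equality is
conditional independence given the restriction to the intersection. -/
lemma shannon_submodular {S T : Set (TdVertex d)} (hS : S.Finite) (hT : T.Finite) :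
    shannon (restrictTo (S ∪ T) μ) + shannon (restrictTo (S ∩ T) μ) ≤
      shannon (restrictTo S μ) + shannon (restrictTo T μ) ∧
    (shannon (restrictTo (S ∪ T) μ) + shannon (restrictTo (S ∩ T) μ) =
        shannon (restrictTo S μ) + shannon (restrictTo T μ) ↔
      ∀ y, μ (cylEvent (S ∪ T) y) * μ (cylEvent (S ∩ T) y) =
        μ (cylEvent S y) * μ (cylEvent T y)) := by
  have hU := hS.union hT
  have : Finite ↥(S ∪ T) := hU
  have : Fintype (↥(S ∪ T) → M) := Fintype.ofFinite _
  have hI : S ∩ T ⊆ S ∪ T := Set.inter_subset_left.trans Set.subset_union_left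
  set p : (↥(S ∪ T) → M) → ℝ := fun z => (restrictTo (S ∪ T) μ).real {z}
  have hcover : (Subtype.val ⁻¹' S ∪ Subtype.val ⁻¹' T : Set ↥(S ∪ T)) = Set.univ :=
    Set.eq_univ_of_forall fun v => v.2
  have huniv : (Subtype.val ⁻¹' (S ∪ T) : Set ↥(S ∪ T)) = Set.univ :=
    Set.eq_univ_of_forall fun v => v.2
  obtain ⟨hle, heq⟩ := entropyOn_submodular (p := p) (fun _ => measureReal_nonneg) hcover
  rw [shannon_restrictTo_eq_entropyOn μ hU subset_rfl, shannon_restrictTo_eq_entropyOn μ hU hI,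
    shannon_restrictTo_eq_entropyOn μ hU Set.subset_union_left,
    shannon_restrictTo_eq_entropyOn μ hU Set.subset_union_right, huniv, Set.preimage_inter]
  refine ⟨hle, heq.trans ?_⟩
  have key : ∀ y : TdVertex d → M,
      (μ (cylEvent (S ∪ T) y) * μ (cylEvent (S ∩ T) y) = μ (cylEvent S y) * μ (cylEvent T y) ↔
        p (fun v => y v.1) *
            marginal p (Subtype.val ⁻¹' S ∩ Subtype.val ⁻¹' T) (fun v => y v.1) =
          marginal p (Subtype.val ⁻¹' S) (fun v => y v.1) *
            marginal p (Subtype.val ⁻¹' T) (fun v => y v.1)) := by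
    intro y
    rw [← ENNReal.toReal_eq_toReal_iff' (by finiteness) (by finiteness), ENNReal.toReal_mul,
      ENNReal.toReal_mul]
    change μ.real _ * μ.real _ = μ.real _ * μ.real _ ↔ _
    rw [measureReal_cylEvent_eq_marginal μ hU subset_rfl,
      measureReal_cylEvent_eq_marginal μ hU hI,
      measureReal_cylEvent_eq_marginal μ hU Set.subset_union_left,
      measureReal_cylEvent_eq_marginal μ hU Set.subset_union_right, huniv, marginal_univ,
      Set.preimage_inter]
  obtain ⟨x⟩ : Nonempty (TdVertex d → M) := nonempty_of_isProbabilityMeasure μ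
  refine ⟨fun h y => (key y).2 (h _), fun h z => ?_⟩
  have hz : (fun v : ↥(S ∪ T) =>
      (fun w => if hw : w ∈ S ∪ T then z ⟨w, hw⟩ else x w) v.1) = z := by
    funext v
    simp only [dif_pos v.2]
  have := (key _).1 (h fun w => if hw : w ∈ S ∪ T then z ⟨w, hw⟩ else x w)
  rwa [hz] at this

/-- Conditional independence given the intersection passes to smaller sets. -/
lemma shannon_modular_mono {S T S' T' : Set (TdVertex d)} (hS : S.Finite) (hT : T.Finite)
    (hS' : S' ⊆ S) (hT' : T' ⊆ T) (hIS : S ∩ T ⊆ S') (hIT : S ∩ T ⊆ T')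
    (h : shannon (restrictTo (S ∪ T) μ) + shannon (restrictTo (S ∩ T) μ) =
      shannon (restrictTo S μ) + shannon (restrictTo T μ)) :
    shannon (restrictTo (S' ∪ T') μ) + shannon (restrictTo (S' ∩ T') μ) =
      shannon (restrictTo S' μ) + shannon (restrictTo T' μ) := by
  have hSf := hS.subset hS'
  have hTf := hT.subset hT'
  have h₁ := (shannon_submodular μ (hS.union hTf) hT).1
  have h₂ := (shannon_submodular μ (hSf.union hTf) hS).1
  have h₃ := (shannon_submodular μ hSf hTf).1
  have e₁ : S ∪ T' ∪ T = S ∪ T := by rw [Set.union_assoc, Set.union_eq_right.2 hT']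
  have e₂ : (S ∪ T') ∩ T = T' := by
    rw [Set.union_inter_distrib_right, Set.inter_eq_left.2 hT', Set.union_eq_right.2 hIT]
  have e₃ : S' ∪ T' ∪ S = S ∪ T' := by
    rw [Set.union_right_comm, Set.union_eq_right.2 hS']
  have e₄ : (S' ∪ T') ∩ S = S' := by
    rw [Set.union_inter_distrib_right, Set.inter_eq_left.2 hS']
    refine Set.union_eq_left.2 fun v hv => hIS ⟨hv.2, hT' hv.1⟩
  have e₅ : S' ∩ T' = S ∩ T :=
    Set.Subset.antisymm (Set.inter_subset_inter hS' hT') (Set.subset_inter hIS hIT)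
  rw [e₁, e₂] at h₁
  rw [e₃, e₄] at h₂
  rw [e₅] at h₃ ⊢
  linarith

end Restriction

/-- Invariance of the entropies under automorphisms of the tree. -/
lemma shannon_restrictTo_preimage {M : Type*} [MeasurableSpace M]
    {μ : Measure (TdVertex d → M)} (hμ : μ ∈ InvMeas d M) (φ : TdGraph d ≃g TdGraph d)
    (S : Set (TdVertex d)) :
    shannon (restrictTo (φ ⁻¹' S) μ) = shannon (restrictTo S μ) := by
  let e : (↥S → M) ≃ᵐ (↥(φ ⁻¹' S) → M) :=
    { toFun := fun a v => a ⟨φ v.1, v.2⟩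
      invFun := fun b v => b ⟨φ.symm v.1, by simp [v.2]⟩
      left_inv := fun a => by simp
      right_inv := fun b => by simp
      measurable_toFun := measurable_pi_lambda _ fun v => measurable_pi_apply _
      measurable_invFun := measurable_pi_lambda _ fun v => measurable_pi_apply _ }
  have hm : Measurable (fun (x : TdVertex d → M) v => x (φ v)) :=
    measurable_pi_lambda _ fun v => measurable_pi_apply _
  have hmap : restrictTo (φ ⁻¹' S) μ = (restrictTo S μ).map e := by
    conv_lhs => rw [← hμ.2 φ]
    rw [restrictTo, restrictTo, Measure.map_map (measurable_restrict _) hm,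
      Measure.map_map e.measurable (measurable_restrict _)]
    rfl
  rw [hmap, shannon, shannon, ← e.toEquiv.tsum_eq]
  refine tsum_congr fun a => ?_
  rw [e.map_apply]
  congr 3
  ext b
  simp
/-! ### Automorphisms of the tree -/

lemma validTd_nil (d : ℕ) : ValidTd d [] := by simp [ValidTd]

lemma validTd_singleton {a : ℕ} : ValidTd d [a] ↔ 1 ≤ a ∧ a ≤ d := by simp [ValidTd]

lemma validTd_cons {a : ℕ} {l : List ℕ} (hl : l ≠ []) :
    ValidTd d (a :: l) ↔ (1 ≤ a ∧ a ≤ d - 1) ∧ ValidTd d l := by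
  obtain ⟨b, t, rfl⟩ := List.exists_cons_of_ne_nil hl
  simp [ValidTd, List.dropLast_cons_cons, and_assoc]

lemma ValidTd.of_cons {a : ℕ} {l : List ℕ} (h : ValidTd d (a :: l)) : ValidTd d l := by
  rcases eq_or_ne l [] with rfl | hl
  · exact validTd_nil d
  · exact ((validTd_cons hl).1 h).2

/-- The automorphism of the tree given by an involution of the labels. -/
def isoOfInvolution (f : List ℕ → List ℕ) (hf : ∀ l, ValidTd d l → ValidTd d (f l))
    (hinv : ∀ l, ValidTd d l → f (f l) = l)
    (hadj : ∀ a l, ValidTd d (a :: l) →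
      (∃ b, f (a :: l) = b :: f l) ∨ (∃ b, f l = b :: f (a :: l))) :
    TdGraph d ≃g TdGraph d where
  toFun v := ⟨f v.1, hf _ v.2⟩
  invFun v := ⟨f v.1, hf _ v.2⟩
  left_inv v := Subtype.ext (hinv _ v.2)
  right_inv v := Subtype.ext (hinv _ v.2)
  map_rel_iff' := by
    have key : ∀ v w : TdVertex d, (TdGraph d).Adj v w →
        (TdGraph d).Adj ⟨f v.1, hf _ v.2⟩ ⟨f w.1, hf _ w.2⟩ := by
      rintro ⟨v, hv⟩ ⟨w, hw⟩ (⟨a, h⟩ | ⟨a, h⟩)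
      · subst h
        exact hadj a v hw
      · subst h
        exact (hadj a w hv).symm
    intro v w
    refine ⟨fun h => ?_, key v w⟩
    have hff : ∀ x : TdVertex d, (⟨f (f x.1), hf _ (hf _ x.2)⟩ : TdVertex d) = x :=
      fun x => Subtype.ext (hinv _ x.2)
    have h' : (TdGraph d).Adj ⟨f (f v.1), hf _ (hf _ v.2)⟩ ⟨f (f w.1), hf _ (hf _ w.2)⟩ :=
      key _ _ h
    rwa [hff, hff] at h'

/-- Apply `f` to the last entry of a list. -/
def mapLast (f : ℕ → ℕ) : List ℕ → List ℕ
  | [] => []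
  | [a] => [f a]
  | a :: b :: l => a :: mapLast f (b :: l)

lemma mapLast_cons (f : ℕ → ℕ) (a : ℕ) {l : List ℕ} (hl : l ≠ []) :
    mapLast f (a :: l) = a :: mapLast f l := by
  obtain ⟨b, t, rfl⟩ := List.exists_cons_of_ne_nil hl
  rfl

lemma length_mapLast (f : ℕ → ℕ) (l : List ℕ) : (mapLast f l).length = l.length := by
  induction l with
  | nil => rfl
  | cons a l ih =>
    rcases eq_or_ne l [] with rfl | hl
    · rfl
    · simp [mapLast_cons f a hl, ih]

lemma mapLast_ne_nil (f : ℕ → ℕ) {l : List ℕ} (hl : l ≠ []) : mapLast f l ≠ [] := by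
  rw [← List.length_pos_iff_ne_nil, length_mapLast]
  exact List.length_pos_iff_ne_nil.2 hl

lemma getLast?_mapLast (f : ℕ → ℕ) (l : List ℕ) :
    (mapLast f l).getLast? = l.getLast?.map f := by
  induction l with
  | nil => rfl
  | cons a l ih =>
    rcases eq_or_ne l [] with rfl | hl
    · rfl
    · rw [mapLast_cons f a hl, List.getLast?_cons_of_ne_nil (mapLast_ne_nil f hl), ih,
        List.getLast?_cons_of_ne_nil hl]

lemma mapLast_mapLast {f : ℕ → ℕ} (hf : ∀ a, f (f a) = a) (l : List ℕ) :
    mapLast f (mapLast f l) = l := by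
  induction l with
  | nil => rfl
  | cons a l ih =>
    rcases eq_or_ne l [] with rfl | hl
    · simp [mapLast, hf]
    · rw [mapLast_cons f a hl, mapLast_cons f a (mapLast_ne_nil f hl), ih]

lemma ValidTd.mapLast {f : ℕ → ℕ} (hf : ∀ a, 1 ≤ a ∧ a ≤ d → 1 ≤ f a ∧ f a ≤ d)
    {l : List ℕ} (h : ValidTd d l) : ValidTd d (mapLast f l) := by
  induction l with
  | nil => exact h
  | cons a l ih =>
    rcases eq_or_ne l [] with rfl | hl
    · exact validTd_singleton.2 (hf a (validTd_singleton.1 h))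
    · rw [mapLast_cons f a hl, validTd_cons (mapLast_ne_nil f hl)]
      rw [validTd_cons hl] at h
      exact ⟨h.1, ih h.2⟩

/-- The automorphism of the tree exchanging two branches at the root. -/
def swapBranches {i j : ℕ} (hi : 1 ≤ i ∧ i ≤ d) (hj : 1 ≤ j ∧ j ≤ d) :
    TdGraph d ≃g TdGraph d :=
  isoOfInvolution (mapLast (Equiv.swap i j))
    (fun l hl => hl.mapLast fun a ha => by
      rw [Equiv.swap_apply_def]
      split_ifs <;> assumption)
    (fun l _ => mapLast_mapLast (Equiv.swap_apply_self i j) l)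
    (fun a l _ => by
      rcases eq_or_ne l [] with rfl | hl
      · exact Or.inl ⟨_, rfl⟩
      · exact Or.inl ⟨_, mapLast_cons _ a hl⟩)

lemma length_swapBranches {i j : ℕ} (hi : 1 ≤ i ∧ i ≤ d) (hj : 1 ≤ j ∧ j ≤ d) (v : TdVertex d) :
    (swapBranches hi hj v).1.length = v.1.length :=
  length_mapLast _ _

lemma getLast?_swapBranches {i j : ℕ} (hi : 1 ≤ i ∧ i ≤ d) (hj : 1 ≤ j ∧ j ≤ d)
    (v : TdVertex d) :
    (swapBranches hi hj v).1.getLast? = v.1.getLast?.map (Equiv.swap i j) :=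
  getLast?_mapLast _ _

/-- The reflection of the labels exchanging the two ends of the edge `{o, 1}`. -/
def flipLabel : List ℕ → List ℕ
  | [] => [1]
  | a :: l => if l = [] then (if a = 1 then [] else [a - 1, 1])
      else if l = [1] then [a + 1] else a :: flipLabel l

lemma flipLabel_eq_nil {l : List ℕ} (h : flipLabel l = []) : l = [1] := by
  cases l with
  | nil => simp [flipLabel] at h
  | cons a l =>
    rw [flipLabel] at h
    split_ifs at h with h₁ h₂
    · rw [h₁, h₂]

lemma flipLabel_eq_one {l : List ℕ} (hl : ValidTd d l) (h : flipLabel l = [1]) : l = [] := by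
  cases l with
  | nil => rfl
  | cons a l =>
    rw [flipLabel] at h
    split_ifs at h with h₁ h₂ h₃
    · simp at h
    · subst h₃
      have := ((validTd_cons (by simp)).1 hl).1.1
      simp at h
      omega
    · simp only [List.cons.injEq] at h
      exact absurd (flipLabel_eq_nil h.2) h₃

lemma flipLabel_cons (a : ℕ) {l : List ℕ} (h₀ : l ≠ []) (h₁ : l ≠ [1]) :
    flipLabel (a :: l) = a :: flipLabel l := by
  rw [flipLabel, if_neg h₀, if_neg h₁]

lemma ValidTd.flipLabel (hd : 1 ≤ d) {l : List ℕ} (h : ValidTd d l) :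
    ValidTd d (flipLabel l) := by
  induction l with
  | nil => exact validTd_singleton.2 ⟨le_rfl, hd⟩
  | cons a l ih =>
    by_cases h₀ : l = []
    · subst h₀
      rw [validTd_singleton] at h
      by_cases ha : a = 1
      · simpa [TreeEntropy.flipLabel, ha] using validTd_nil d
      · simp only [TreeEntropy.flipLabel, if_true, if_neg ha]
        rw [validTd_cons (by simp), validTd_singleton]
        omega
    · by_cases h₁ : l = [1]
      · subst h₁
        rw [validTd_cons (by simp)] at h
        simp only [TreeEntropy.flipLabel, if_neg h₀, if_true, validTd_singleton]
        omega
      · rw [validTd_cons h₀] at h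
        rw [flipLabel_cons a h₀ h₁, validTd_cons fun h' => h₁ (flipLabel_eq_nil h')]
        exact ⟨h.1, ih h.2⟩

lemma flipLabel_flipLabel {l : List ℕ} (h : ValidTd d l) : flipLabel (flipLabel l) = l := by
  induction l with
  | nil => simp [flipLabel]
  | cons a l ih =>
    by_cases h₀ : l = []
    · subst h₀
      rw [validTd_singleton] at h
      by_cases ha : a = 1
      · simp [flipLabel, ha]
      · simp [flipLabel, ha]
        omega
    · by_cases h₁ : l = [1]
      · subst h₁
        rw [validTd_cons (by simp)] at h
        simp [flipLabel]
        omega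
      · rw [flipLabel_cons a h₀ h₁, flipLabel_cons a (fun h' => h₁ (flipLabel_eq_nil h'))
          (fun h' => h₀ (flipLabel_eq_one h.of_cons h')), ih h.of_cons]

/-- The reflection of the labels exchanges the two sides of the edge `{o, 1}`. -/
lemma length_flipLabel {l : List ℕ} (h : ValidTd d l) :
    (l.getLast? = some 1 ∧ (flipLabel l).length + 1 = l.length) ∨
      (l.getLast? ≠ some 1 ∧ (flipLabel l).length = l.length + 1) := by
  induction l with
  | nil => simp [flipLabel]
  | cons a l ih =>
    by_cases h₀ : l = []
    · subst h₀
      by_cases ha : a = 1 <;> simp [flipLabel, ha]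
    · by_cases h₁ : l = [1]
      · subst h₁
        simp [flipLabel]
      · rw [flipLabel_cons a h₀ h₁, List.getLast?_cons_of_ne_nil h₀]
        simpa using ih h.of_cons

/-- The automorphism of the tree reversing the edge `{o, 1}`. -/
def flipEdge (hd : 1 ≤ d) : TdGraph d ≃g TdGraph d :=
  isoOfInvolution flipLabel (fun _ h => h.flipLabel hd) (fun _ h => flipLabel_flipLabel h)
    (fun a l _ => by
      by_cases h₀ : l = []
      · subst h₀
        by_cases ha : a = 1 <;> simp [flipLabel, ha]
      · by_cases h₁ : l = [1]
        · subst h₁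
          exact Or.inl ⟨a + 1, by simp [flipLabel]⟩
        · exact Or.inl ⟨a, flipLabel_cons a h₀ h₁⟩)

lemma length_flipEdge (hd : 1 ≤ d) (v : TdVertex d) :
    (v.1.getLast? = some 1 ∧ (flipEdge hd v).1.length + 1 = v.1.length) ∨
      (v.1.getLast? ≠ some 1 ∧ (flipEdge hd v).1.length = v.1.length + 1) :=
  length_flipLabel v.2

/-! ### Distances in the tree -/

/-- The length of the longest common prefix. -/
def commonLength (a b : List ℕ) : ℕ :=
  ((a.zip b).takeWhile (fun p => p.1 = p.2)).length

lemma commonLength_concat (a b : List ℕ) (i : ℕ) :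
    commonLength a (b ++ [i]) = commonLength a b ∨
      commonLength a (b ++ [i]) = b.length + 1 := by
  induction b generalizing a with
  | nil =>
    cases a with
    | nil => simp [commonLength]
    | cons x a => by_cases h : x = i <;> simp [commonLength, h]
  | cons y b ih =>
    cases a with
    | nil => simp [commonLength]
    | cons x a =>
      by_cases h : x = y
      · simpa [commonLength, h] using ih a
      · simp [commonLength, h]

lemma treeDist_eq (u w : List ℕ) : treeDist u w =
    (u.length - commonLength u.reverse w.reverse) +
      (w.length - commonLength u.reverse w.reverse) := rfl

lemma treeDist_nil (v : List ℕ) : treeDist v [] = v.length := by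
  simp [treeDist]

lemma treeDist_singleton (v : List ℕ) (k : ℕ) :
    (v.getLast? = some k ∧ treeDist v [k] + 1 = v.length) ∨
      (v.getLast? ≠ some k ∧ treeDist v [k] = v.length + 1) := by
  rcases List.eq_nil_or_concat v with rfl | ⟨l, x, rfl⟩
  · simp [treeDist]
  · by_cases h : x = k <;> simp [treeDist, h]

/-- The vertices on the side of a child are its descendants. -/
lemma treeDist_of_lt {v u : List ℕ} {i : ℕ} (h : treeDist v (i :: u) < treeDist v u) :
    treeDist v (i :: u) + (u.length + 1) ≤ max v.length (u.length + 1) := by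
  rw [treeDist_eq, treeDist_eq v u, List.reverse_cons] at h
  rw [treeDist_eq, List.reverse_cons]
  rcases commonLength_concat v.reverse u.reverse i with hc | hc
  · rw [hc] at h
    simp only [List.length_cons] at h
    omega
  · rw [hc]
    simp only [List.length_cons, List.length_reverse]
    omega
/-! ### Balls, edge neighborhoods and partial balls -/

/-- The vertices of depth less than `r`, together with those of the branch of the neighbor `k` of
the root of depth at most `n`. -/
def branchBall (d k r n : ℕ) : Set (TdVertex d) :=
  {v | v.1.length + 1 ≤ r ∨ (v.1.getLast? = some k ∧ v.1.length ≤ n)}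

/-- The ball `S_r` together with the vertices of depth `r + 1` of the branches `1, …, k`. -/
def partialBall (d r k : ℕ) : Set (TdVertex d) :=
  {v | v.1.length ≤ r ∨ (v.1.length ≤ r + 1 ∧ ∀ i ∈ v.1.getLast?, i ≤ k)}

/-- The ball `S_{r+1}` without the vertices of depth `r + 1` of the branch `k`. -/
def coBranch (d r k : ℕ) : Set (TdVertex d) :=
  {v | v.1.length ≤ r ∨ (v.1.length ≤ r + 1 ∧ v.1.getLast? ≠ some k)}

lemma TdVertex.getLast?_cases (v : TdVertex d) :
    (v.1.length = 0 ∧ v.1.getLast? = none) ∨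
      ∃ a, 1 ≤ v.1.length ∧ v.1.getLast? = some a ∧ 1 ≤ a ∧ a ≤ d := by
  rcases h : v.1.getLast? with _ | a
  · left
    simpa using h
  · refine Or.inr ⟨a, ?_, rfl, v.2.2 a h⟩
    rw [Nat.one_le_iff_ne_zero]
    intro h0
    simp [List.length_eq_zero_iff.1 h0] at h

lemma finite_SrSet (d r : ℕ) : (SrSet d r).Finite := by
  have hfin := (List.finite_length_le (Fin (d + 1)) r).image (List.map Fin.val)
  refine Set.Finite.of_finite_image (f := Subtype.val) (hfin.subset ?_)
    Subtype.val_injective.injOn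
  rintro _ ⟨v, hv, rfl⟩
  have hle : ∀ l : List ℕ, ValidTd d l → ∀ a ∈ l, a < d + 1 := by
    intro l
    induction l with
    | nil => simp
    | cons b l ih =>
      intro h a ha
      rcases List.mem_cons.1 ha with rfl | ha
      · rcases eq_or_ne l [] with rfl | hl
        · have := validTd_singleton.1 h
          omega
        · have := ((validTd_cons hl).1 h).1
          omega
      · exact ih h.of_cons a ha
  refine ⟨v.1.pmap Fin.mk (hle _ v.2), ?_, ?_⟩
  · change (List.pmap _ _ _).length ≤ r
    rw [List.length_pmap]
    exact hv
  · simp [List.map_pmap]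

section SetIdentities

variable {r k : ℕ}

lemma branchBall_subset_SrSet {n m : ℕ} (hr : r ≤ m + 1) (hn : n ≤ m) :
    branchBall d k r n ⊆ SrSet d m := by
  rintro v (h | ⟨-, h⟩) <;> simp only [SrSet, Set.mem_ofPred_eq] <;> omega

lemma partialBall_subset_SrSet : partialBall d r k ⊆ SrSet d (r + 1) := by
  rintro v (h | ⟨h, -⟩) <;> simp only [SrSet, Set.mem_ofPred_eq] <;> omega

lemma coBranch_subset_SrSet : coBranch d r k ⊆ SrSet d (r + 1) := by
  rintro v (h | ⟨h, -⟩) <;> simp only [SrSet, Set.mem_ofPred_eq] <;> omega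

lemma partialBall_zero : partialBall d r 0 = SrSet d r := by
  ext v
  rcases v.getLast?_cases with ⟨h, h'⟩ | ⟨a, h, h', h₁, h₂⟩ <;>
    simp [partialBall, SrSet, h'] <;> omega

lemma partialBall_self : partialBall d r d = SrSet d (r + 1) := by
  ext v
  rcases v.getLast?_cases with ⟨h, h'⟩ | ⟨a, h, h', h₁, h₂⟩ <;>
    simp [partialBall, SrSet, h'] <;> omega

lemma coBranch_last (hd : 1 ≤ d) : coBranch d r d = partialBall d r (d - 1) := by
  ext v
  rcases v.getLast?_cases with ⟨h, h'⟩ | ⟨a, h, h', h₁, h₂⟩ <;>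
    simp [partialBall, coBranch, h'] <;> omega

lemma partialBall_union_branchBall :
    partialBall d r k ∪ branchBall d (k + 1) r (r + 1) = partialBall d r (k + 1) := by
  ext v
  rcases v.getLast?_cases with ⟨h, h'⟩ | ⟨a, h, h', h₁, h₂⟩ <;>
    simp [partialBall, branchBall, h'] <;> omega

lemma partialBall_inter_branchBall :
    partialBall d r k ∩ branchBall d (k + 1) r (r + 1) = branchBall d (k + 1) r r := by
  ext v
  rcases v.getLast?_cases with ⟨h, h'⟩ | ⟨a, h, h', h₁, h₂⟩ <;>
    simp [partialBall, branchBall, h'] <;> omega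

lemma partialBall_union_branchBall_succ :
    partialBall d r k ∪ branchBall d (k + 1) (r + 1) (r + 1) = partialBall d r (k + 1) := by
  ext v
  rcases v.getLast?_cases with ⟨h, h'⟩ | ⟨a, h, h', h₁, h₂⟩ <;>
    simp [partialBall, branchBall, h'] <;> omega

lemma partialBall_inter_branchBall_succ :
    partialBall d r k ∩ branchBall d (k + 1) (r + 1) (r + 1) = SrSet d r := by
  ext v
  rcases v.getLast?_cases with ⟨h, h'⟩ | ⟨a, h, h', h₁, h₂⟩ <;>
    simp [partialBall, branchBall, SrSet, h'] <;> omega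

lemma SrSet_union_branchBall :
    SrSet d r ∪ branchBall d k r (r + 1) = branchBall d k (r + 1) (r + 1) := by
  ext v
  rcases v.getLast?_cases with ⟨h, h'⟩ | ⟨a, h, h', h₁, h₂⟩ <;>
    simp [branchBall, SrSet, h'] <;> omega

lemma SrSet_inter_branchBall :
    SrSet d r ∩ branchBall d k r (r + 1) = branchBall d k r r := by
  ext v
  rcases v.getLast?_cases with ⟨h, h'⟩ | ⟨a, h, h', h₁, h₂⟩ <;>
    simp [branchBall, SrSet, h'] <;> omega

lemma coBranch_union_branchBall :
    coBranch d r k ∪ branchBall d k r (r + 1) = SrSet d (r + 1) := by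
  ext v
  rcases v.getLast?_cases with ⟨h, h'⟩ | ⟨a, h, h', h₁, h₂⟩ <;>
    simp [coBranch, branchBall, SrSet, h'] <;> omega

lemma coBranch_inter_branchBall :
    coBranch d r k ∩ branchBall d k r (r + 1) = branchBall d k r r := by
  ext v
  rcases v.getLast?_cases with ⟨h, h'⟩ | ⟨a, h, h', h₁, h₂⟩ <;>
    simp [coBranch, branchBall, h'] <;> omega

lemma edgeBall_root_inter (hr : 1 ≤ r) {u w : TdVertex d} (hu : u.1 = []) (hw : w.1 = [k]) :
    edgeBall r u w ∩ SrSet d (r + 1) = branchBall d k r r := by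
  ext v
  simp only [edgeBall, SrSet, branchBall, Set.mem_inter_iff, Set.mem_ofPred_eq, hu, hw,
    treeDist_nil]
  rcases treeDist_singleton v.1 k with ⟨h, h'⟩ | ⟨h, h'⟩ <;> simp [h] <;> omega

lemma mem_sideOf_root {u w : TdVertex d} (hu : u.1 = []) (hw : w.1 = [k]) (v : TdVertex d) :
    v ∈ sideOf u w ↔ v.1.getLast? ≠ some k := by
  simp only [sideOf, Set.mem_ofPred_eq, hu, hw, treeDist_nil]
  rcases treeDist_singleton v.1 k with ⟨h, h'⟩ | ⟨h, h'⟩ <;> simp [h] <;> omega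

lemma mem_sideOf_child {u w : TdVertex d} (hu : u.1 = []) (hw : w.1 = [k]) (v : TdVertex d) :
    v ∈ sideOf w u ↔ v.1.getLast? = some k := by
  simp only [sideOf, Set.mem_ofPred_eq, hu, hw, treeDist_nil]
  rcases treeDist_singleton v.1 k with ⟨h, h'⟩ | ⟨h, h'⟩ <;> simp [h] <;> omega

/-- Below a vertex other than the root, the ball `S_{r+1}` is contained in the neighborhood of the
edge to a child. -/
lemma sideOf_inter_subset_edgeBall (hr : 1 ≤ r) {u w : TdVertex d} {i : ℕ} (h : w.1 = i :: u.1)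
    (hu : u.1 ≠ []) : sideOf w u ∩ SrSet d (r + 1) ⊆ edgeBall r u w ∩ SrSet d (r + 1) := by
  rintro v ⟨hv, hvr⟩
  refine ⟨Or.inr ?_, hvr⟩
  simp only [sideOf, SrSet, Set.mem_ofPred_eq, h] at hv hvr ⊢
  have h₁ := treeDist_of_lt hv
  have h₂ := List.length_pos_iff_ne_nil.2 hu
  omega

end SetIdentities

lemma edgeBall_comm (r : ℕ) (u w : TdVertex d) : edgeBall r u w = edgeBall r w u := by
  ext v
  exact or_comm

/-! ### Entropies of balls -/

section Invariant

variable {M : Type*} [MeasurableSpace M] {μ : Measure (TdVertex d → M)} {r : ℕ}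

lemma shannon_branchBall (hμ : μ ∈ InvMeas d M) {k : ℕ} (hk : 1 ≤ k ∧ k ≤ d) (r n : ℕ) :
    shannon (restrictTo (branchBall d k r n) μ) = shannon (restrictTo (branchBall d 1 r n) μ) := by
  have h1 : 1 ≤ 1 ∧ 1 ≤ d := ⟨le_rfl, hk.1.trans hk.2⟩
  rw [← shannon_restrictTo_preimage hμ (swapBranches hk h1) (branchBall d 1 r n)]
  refine congrArg (fun S => shannon (restrictTo S μ)) (Set.ext fun v => ?_)
  simp only [branchBall, Set.mem_preimage, Set.mem_ofPred_eq, length_swapBranches,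
    getLast?_swapBranches, Option.map_eq_some_iff]
  simp [Equiv.swap_apply_eq_iff]

lemma shannon_coBranch (hμ : μ ∈ InvMeas d M) {k : ℕ} (hk : 1 ≤ k ∧ k ≤ d) (r : ℕ) :
    shannon (restrictTo (coBranch d r k) μ) =
      shannon (restrictTo (partialBall d r (d - 1)) μ) := by
  have hd : 1 ≤ d := hk.1.trans hk.2
  rw [← coBranch_last hd,
    ← shannon_restrictTo_preimage hμ (swapBranches hk ⟨hd, le_rfl⟩) (coBranch d r d)]
  refine congrArg (fun S => shannon (restrictTo S μ)) (Set.ext fun v => ?_)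
  simp only [coBranch, Set.mem_preimage, Set.mem_ofPred_eq, length_swapBranches,
    getLast?_swapBranches, Option.map_eq_some_iff, ne_eq]
  simp [Equiv.swap_apply_eq_iff]

/-- The ball of radius `r` around a neighbor of the root has the entropy of `S_r`. -/
lemma shannon_branchBall_succ (hμ : μ ∈ InvMeas d M) {k : ℕ} (hk : 1 ≤ k ∧ k ≤ d) (r : ℕ) :
    shannon (restrictTo (branchBall d k r (r + 1)) μ) = shannon (restrictTo (SrSet d r) μ) := by
  rw [shannon_branchBall hμ hk,
    ← shannon_restrictTo_preimage hμ (flipEdge (hk.1.trans hk.2)) (SrSet d r)]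
  refine congrArg (fun S => shannon (restrictTo S μ)) (Set.ext fun v => ?_)
  simp only [branchBall, SrSet, Set.mem_preimage, Set.mem_ofPred_eq]
  rcases length_flipEdge (hk.1.trans hk.2) v with ⟨h, h'⟩ | ⟨h, h'⟩ <;> simp [h] <;> omega

variable [Fintype M] [DiscreteMeasurableSpace M]

lemma ErSet_eq_branchBall (d r : ℕ) : ErSet d r = branchBall d 1 r r := rfl

/-- Adding the last layer of one branch increases the entropy by at most
`H(X_{S_r}) - H(X_{E_r})`. -/
lemma shannon_partialBall_succ_le (hμ : μ ∈ InvMeas d M) {k : ℕ} (hk : k < d) :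
    shannon (restrictTo (partialBall d r (k + 1)) μ) + shannon (restrictTo (ErSet d r) μ) ≤
      shannon (restrictTo (partialBall d r k) μ) + shannon (restrictTo (SrSet d r) μ) := by
  have := hμ.1
  have h := (shannon_submodular μ ((finite_SrSet d (r + 1)).subset
    (partialBall_subset_SrSet (k := k)))
    ((finite_SrSet d (r + 1)).subset (branchBall_subset_SrSet (k := k + 1) (r := r) (by omega)
      le_rfl))).1
  rwa [partialBall_union_branchBall, partialBall_inter_branchBall,
    shannon_branchBall hμ ⟨by omega, hk⟩, shannon_branchBall_succ hμ ⟨by omega, hk⟩] at h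

/-- Adding the last layer of one branch increases the entropy by at most
`H(X_{E_{r+1}}) - H(X_{S_r})`. -/
lemma shannon_partialBall_succ_le' (hμ : μ ∈ InvMeas d M) {k : ℕ} (hk : k < d) :
    shannon (restrictTo (partialBall d r (k + 1)) μ) + shannon (restrictTo (SrSet d r) μ) ≤
      shannon (restrictTo (partialBall d r k) μ) + shannon (restrictTo (ErSet d (r + 1)) μ) := by
  have := hμ.1
  have h := (shannon_submodular μ ((finite_SrSet d (r + 1)).subset
    (partialBall_subset_SrSet (k := k)))
    ((finite_SrSet d (r + 1)).subset (branchBall_subset_SrSet (k := k + 1) (r := r + 1) (by omega)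
      le_rfl))).1
  rwa [partialBall_union_branchBall_succ, partialBall_inter_branchBall_succ,
    shannon_branchBall hμ ⟨by omega, hk⟩] at h

lemma shannon_ErSet_succ_le (hd : 1 ≤ d) (hμ : μ ∈ InvMeas d M) :
    shannon (restrictTo (ErSet d (r + 1)) μ) + shannon (restrictTo (ErSet d r) μ) ≤
      shannon (restrictTo (SrSet d r) μ) + shannon (restrictTo (SrSet d r) μ) := by
  have := hμ.1
  have h := (shannon_submodular μ (finite_SrSet d r)
    ((finite_SrSet d (r + 1)).subset (branchBall_subset_SrSet (k := 1) (r := r) (by omega)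
      le_rfl))).1
  rwa [SrSet_union_branchBall, SrSet_inter_branchBall,
    shannon_branchBall_succ hμ ⟨le_rfl, hd⟩] at h

lemma shannon_partialBall_le (hμ : μ ∈ InvMeas d M) {k : ℕ} (hk : k ≤ d) :
    shannon (restrictTo (partialBall d r k) μ) ≤ shannon (restrictTo (SrSet d r) μ) +
      k * (shannon (restrictTo (SrSet d r) μ) - shannon (restrictTo (ErSet d r) μ)) := by
  induction k with
  | zero => rw [partialBall_zero]; simp
  | succ k ih =>
    push_cast
    linarith [ih (by omega), shannon_partialBall_succ_le (r := r) hμ hk]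

lemma shannon_partialBall_le' (hμ : μ ∈ InvMeas d M) {k : ℕ} (hk : k ≤ d) :
    shannon (restrictTo (partialBall d r k) μ) ≤ shannon (restrictTo (SrSet d r) μ) +
      k * (shannon (restrictTo (ErSet d (r + 1)) μ) - shannon (restrictTo (SrSet d r) μ)) := by
  induction k with
  | zero => rw [partialBall_zero]; simp
  | succ k ih =>
    push_cast
    linarith [ih (by omega), shannon_partialBall_succ_le' (r := r) hμ hk]

/-- The Markov property on `S_{r+1}` amounts to the extremality of the entropy of `S_{r+1}`. -/
lemma rMarkovOn_iff_shannon (hd : 1 ≤ d) (hμ : μ ∈ InvMeas d M) (hr : 1 ≤ r) :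
    rMarkovOn r (SrSet d (r + 1)) μ ↔
      shannon (restrictTo (SrSet d (r + 1)) μ) = shannon (restrictTo (SrSet d r) μ) +
        d * (shannon (restrictTo (SrSet d r) μ) - shannon (restrictTo (ErSet d r) μ)) := by
  have := hμ.1
  have hfin := finite_SrSet d (r + 1)
  have hBfin : ∀ k, (branchBall d k r (r + 1)).Finite := fun k =>
    hfin.subset (branchBall_subset_SrSet (by omega) le_rfl)
  constructor
  · intro hM
    have hstep : ∀ k < d, shannon (restrictTo (partialBall d r (k + 1)) μ) +
        shannon (restrictTo (ErSet d r) μ) =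
          shannon (restrictTo (partialBall d r k) μ) + shannon (restrictTo (SrSet d r) μ) := by
      intro k hk
      let o : TdVertex d := ⟨[], validTd_nil d⟩
      let w : TdVertex d := ⟨[k + 1], validTd_singleton.2 ⟨by omega, hk⟩⟩
      have hPfin := hfin.subset (partialBall_subset_SrSet (d := d) (r := r) (k := k))
      have hE := edgeBall_root_inter hr (u := o) (w := w) (k := k + 1) rfl rfl
      have hEP : branchBall d (k + 1) r r ⊆ partialBall d r k := by
        rw [← partialBall_inter_branchBall]; exact Set.inter_subset_left
      have hEB : branchBall d (k + 1) r r ⊆ branchBall d (k + 1) r (r + 1) := by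
        rw [← partialBall_inter_branchBall]; exact Set.inter_subset_right
      have e₁ : sideOf o w ∩ partialBall d r k ∪ branchBall d (k + 1) r r = partialBall d r k := by
        ext v
        simp only [Set.mem_union, Set.mem_inter_iff, mem_sideOf_root (u := o) (w := w) rfl rfl]
        refine ⟨fun h => h.elim And.right fun h => hEP h, fun h => ?_⟩
        by_cases hv : v.1.getLast? = some (k + 1)
        · right
          rw [← partialBall_inter_branchBall]
          exact ⟨h, Or.inr ⟨hv, partialBall_subset_SrSet h⟩⟩
        · exact Or.inl ⟨hv, h⟩
      have e₂ : sideOf w o ∩ branchBall d (k + 1) r (r + 1) ∪ branchBall d (k + 1) r r =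
          branchBall d (k + 1) r (r + 1) := by
        ext v
        simp only [Set.mem_union, Set.mem_inter_iff, mem_sideOf_child (u := o) (w := w) rfl rfl]
        refine ⟨fun h => h.elim And.right fun h => hEB h, fun h => ?_⟩
        rcases h with h | h
        · exact Or.inr (Or.inl h)
        · exact Or.inl ⟨h.1, Or.inr h⟩
      have hCI := hM o w (show ([] : List ℕ).length ≤ r + 1 by simp)
        (show [k + 1].length ≤ r + 1 by simp) (Or.inl ⟨k + 1, rfl⟩)
        (hPfin.subset Set.inter_subset_right : (sideOf o w ∩ partialBall d r k).Finite).toFinset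
        ((hBfin (k + 1)).subset Set.inter_subset_right :
          (sideOf w o ∩ branchBall d (k + 1) r (r + 1)).Finite).toFinset
        (by
          rw [Set.Finite.coe_toFinset]
          exact Set.inter_subset_inter_right _ partialBall_subset_SrSet)
        (by
          rw [Set.Finite.coe_toFinset]
          exact Set.inter_subset_inter_right _ (branchBall_subset_SrSet (by omega) le_rfl))
      simp only [Set.Finite.coe_toFinset, hE, Set.union_union_distrib_right, e₁, e₂] at hCI
      have h := (shannon_submodular μ hPfin (hBfin (k + 1))).2.2 (by
        rw [partialBall_inter_branchBall]
        exact hCI)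
      rwa [partialBall_union_branchBall, partialBall_inter_branchBall,
        shannon_branchBall hμ ⟨by omega, hk⟩, shannon_branchBall_succ hμ ⟨by omega, hk⟩] at h
    have hsum : ∀ k ≤ d, shannon (restrictTo (partialBall d r k) μ) =
        shannon (restrictTo (SrSet d r) μ) +
          k * (shannon (restrictTo (SrSet d r) μ) - shannon (restrictTo (ErSet d r) μ)) := by
      intro k hk
      induction k with
      | zero => rw [partialBall_zero]; simp
      | succ k ih =>
        push_cast
        linarith [ih (by omega), hstep k hk]
    rw [← partialBall_self]
    exact hsum d le_rfl
  · intro hmax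
    have hext : ∀ k, 1 ≤ k ∧ k ≤ d →
        shannon (restrictTo (coBranch d r k ∪ branchBall d k r (r + 1)) μ) +
            shannon (restrictTo (coBranch d r k ∩ branchBall d k r (r + 1)) μ) =
          shannon (restrictTo (coBranch d r k) μ) +
            shannon (restrictTo (branchBall d k r (r + 1)) μ) := by
      intro k hk
      refine le_antisymm
        (shannon_submodular μ (hfin.subset coBranch_subset_SrSet) (hBfin k)).1 ?_
      rw [coBranch_union_branchBall, coBranch_inter_branchBall, shannon_coBranch hμ hk,
        shannon_branchBall_succ hμ hk, shannon_branchBall hμ hk, ← ErSet_eq_branchBall, hmax]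
      have h := shannon_partialBall_le (r := r) hμ (Nat.sub_le d 1)
      rw [Nat.cast_sub hd, Nat.cast_one] at h
      linarith
    have hchild : ∀ u w : TdVertex d, (∃ i, w.1 = i :: u.1) → ∀ F₁ F₂ : Finset (TdVertex d),
        ↑F₁ ⊆ sideOf u w ∩ SrSet d (r + 1) → ↑F₂ ⊆ sideOf w u ∩ SrSet d (r + 1) →
        ∀ y : TdVertex d → M,
          μ (cylEvent (↑F₁ ∪ ↑F₂ ∪ (edgeBall r u w ∩ SrSet d (r + 1))) y)
              * μ (cylEvent (edgeBall r u w ∩ SrSet d (r + 1)) y)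
            = μ (cylEvent (↑F₁ ∪ (edgeBall r u w ∩ SrSet d (r + 1))) y)
              * μ (cylEvent (↑F₂ ∪ (edgeBall r u w ∩ SrSet d (r + 1))) y) := by
      rintro u w ⟨k, hw⟩ F₁ F₂ h₁ h₂ y
      by_cases hu : u.1 = []
      · rw [hu] at hw
        have hk : 1 ≤ k ∧ k ≤ d := validTd_singleton.1 (hw ▸ w.2)
        rw [edgeBall_root_inter hr hu hw]
        have hEV : branchBall d k r r ⊆ coBranch d r k := by
          rw [← coBranch_inter_branchBall]; exact Set.inter_subset_left
        have hEB : branchBall d k r r ⊆ branchBall d k r (r + 1) := by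
          rw [← coBranch_inter_branchBall]; exact Set.inter_subset_right
        have hF₁ : (F₁ : Set (TdVertex d)) ∪ branchBall d k r r ⊆ coBranch d r k :=
          Set.union_subset (fun v hv => Or.inr
            ⟨(h₁ hv).2, (mem_sideOf_root hu hw v).1 (h₁ hv).1⟩) hEV
        have hF₂ : (F₂ : Set (TdVertex d)) ∪ branchBall d k r r ⊆ branchBall d k r (r + 1) :=
          Set.union_subset (fun v hv => Or.inr
            ⟨(mem_sideOf_child hu hw v).1 (h₂ hv).1, (h₂ hv).2⟩) hEB
        have hVfin := hfin.subset (coBranch_subset_SrSet (d := d) (r := r) (k := k))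
        have hmod := shannon_modular_mono μ hVfin (hBfin k) hF₁ hF₂
          (by rw [coBranch_inter_branchBall]; exact Set.subset_union_right)
          (by rw [coBranch_inter_branchBall]; exact Set.subset_union_right) (hext k hk)
        have h := (shannon_submodular μ (hVfin.subset hF₁) ((hBfin k).subset hF₂)).2.1 hmod y
        have hinter : ((F₁ : Set (TdVertex d)) ∪ branchBall d k r r) ∩
            (↑F₂ ∪ branchBall d k r r) = branchBall d k r r := by
          refine Set.Subset.antisymm ?_
            (Set.subset_inter Set.subset_union_right Set.subset_union_right)
          exact (Set.inter_subset_inter hF₁ hF₂).trans coBranch_inter_branchBall.subset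
        rwa [hinter, ← Set.union_union_distrib_right] at h
      · have hsub := h₂.trans (sideOf_inter_subset_edgeBall hr hw hu)
        rw [Set.union_assoc, Set.union_eq_right.2 hsub]
    intro u w _ _ hadj F₁ F₂ h₁ h₂ y
    rcases hadj with hadj | hadj
    · exact hchild u w hadj F₁ F₂ h₁ h₂ y
    · have h := hchild w u hadj F₂ F₁ h₂ h₁ y
      rw [edgeBall_comm, Set.union_comm (F₂ : Set (TdVertex d))] at h
      rw [h, mul_comm]

end Invariant

/-- For every invariant process `X` with law in `I_d(M)` and every integer
`r ≥ 1`, `Σ_{r+1}(X) ≤ Σ_r(X)`, with equality iff the restriction of `X` to `S_{r+1}` is an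
`r`-Markov process on `S_{r+1}`. -/
theorem Sigma_antitone_iff_markov
    (d : ℕ) (hd : 3 ≤ d) (M : Type) [Fintype M] [MeasurableSpace M]
    [DiscreteMeasurableSpace M]
    (μ : Measure (TdVertex d → M)) (hμ : μ ∈ InvMeas d M) (r : ℕ) (hr : 1 ≤ r) :
    SigmaR d (r + 1) μ ≤ SigmaR d r μ ∧
    (SigmaR d (r + 1) μ = SigmaR d r μ ↔ rMarkovOn r (SrSet d (r + 1)) μ) := by
  have hd1 : 1 ≤ d := by omega
  have hdpos : (0 : ℝ) < d := by exact_mod_cast hd1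
  rw [rMarkovOn_iff_shannon hd1 hμ hr]
  have h₁ := shannon_partialBall_le' (r := r) hμ le_rfl
  have h₂ := shannon_ErSet_succ_le (r := r) hd1 hμ
  rw [partialBall_self] at h₁
  unfold SigmaR
  set S := shannon (restrictTo (SrSet d r) μ)
  set S' := shannon (restrictTo (SrSet d (r + 1)) μ)
  set E := shannon (restrictTo (ErSet d r) μ)
  set E' := shannon (restrictTo (ErSet d (r + 1)) μ)
  have h₃ : 0 ≤ d * (S + S - E' - E) := mul_nonneg hdpos.le (by linarith)
  refine ⟨by linarith, fun h => ?_, fun h => ?_⟩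
  · linarith
  · linarith

end TreeEntropy
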